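/- arXiv:2112.08188 — 2 statements merged into one kernel-verified Lean document; each statement's English description precedes it below -/
import Mathlib

section
/- Let G be a finite cut group which is a Frobenius group or a 2-Frobenius group. Then at most 3 primes divide the order of G. -/
/-- An element `g` of a group is *rational* if `g ^ k` is conjugate to `g`
for every integer `k` coprime to the order of `g`. -/
def IsRationalElement {G : Type*} [Group G] (g : G) : Prop :=
  ∀ k : ℤ, Int.gcd k (orderOf g) = 1 → IsConj (g ^ k) g

/-- An element `g` of a group is *inverse semi-rational* if `g ^ k` is conjugate
to `g` or to `g⁻¹` for every integer `k` coprime to the order of `g`. -/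
def IsInverseSemiRationalElement {G : Type*} [Group G] (g : G) : Prop :=
  ∀ k : ℤ, Int.gcd k (orderOf g) = 1 → IsConj (g ^ k) g ∨ IsConj (g ^ k) g⁻¹

/-- A group is a *cut group* if every element is inverse semi-rational. -/
def IsCutGroup (G : Type*) [Group G] : Prop :=
  ∀ g : G, IsInverseSemiRationalElement g

/-- A group is *rational* if every element is rational. -/
def IsRationalGroup (G : Type*) [Group G] : Prop :=
  ∀ g : G, IsRationalElement g

/-- A finite group is a *Frobenius group* if it has a non-trivial proper subgroup `H`
such that `H ∩ x⁻¹Hx = 1` for every `x ∉ H`. -/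
def IsFrobeniusGroup (G : Type*) [Group G] : Prop :=
  ∃ H : Subgroup G, H ≠ ⊥ ∧ H ≠ ⊤ ∧
    ∀ x : G, x ∉ H → ∀ g : G, g ∈ H → x * g * x⁻¹ ∈ H → g = 1

/-- `G` is a Frobenius group with kernel `N` if `N` is a non-trivial proper normal
subgroup and there is a subgroup `H` with `G = NH`, `N ∩ H = 1`, and the centralizer
of every non-trivial element of `N` is contained in `N`. -/
def IsFrobeniusGroupWithKernel (G : Type*) [Group G] (N : Subgroup G) : Prop :=
  N ≠ ⊥ ∧ N ≠ ⊤ ∧ N.Normal ∧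
    ∃ H : Subgroup G, N ⊔ H = ⊤ ∧ N ⊓ H = ⊥ ∧
      ∀ g : G, g ∈ N → g ≠ 1 → Subgroup.centralizer {g} ≤ N

/-- `G` is a *2-Frobenius group* if it has normal subgroups `N ≤ K` such that `K` is
a Frobenius group with kernel `N` and `G/N` is a Frobenius group with kernel `K/N`. -/
def Is2FrobeniusGroup (G : Type*) [Group G] : Prop :=
  ∃ (N K : Subgroup G) (hN : N.Normal), K.Normal ∧ N ≤ K ∧
    IsFrobeniusGroupWithKernel ↥K (N.subgroupOf K) ∧
    (letI := hN
     IsFrobeniusGroupWithKernel (G ⧸ N) (K.map (QuotientGroup.mk' N)))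

universe u

namespace Representation

section Characters
variable {G : Type*} [Group G]

theorem char_eq_add_of_isCompl {V : Type*} [AddCommGroup V] [Module ℂ V] [FiniteDimensional ℂ V]
    {ρ : Representation ℂ G V} {σ τ : Subrepresentation ρ} (h : IsCompl σ τ) :
    IsCompl σ.toSubmodule τ.toSubmodule ∧
    ρ.character = σ.toRepresentation.character + τ.toRepresentation.character := by
  have hc : IsCompl σ.toSubmodule τ.toSubmodule := by
    refine ⟨disjoint_iff.2 ?_, codisjoint_iff.2 ?_⟩
    · rw [← Subrepresentation.toSubmodule_inf, h.inf_eq_bot]; rfl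
    · rw [← Subrepresentation.toSubmodule_sup, h.sup_eq_top]; rfl
  refine ⟨hc, ?_⟩
  funext g
  set e := Submodule.prodEquivOfIsCompl _ _ hc
  have key : ρ g = e.conj ((σ.toRepresentation g).prodMap (τ.toRepresentation g)) := by
    refine LinearMap.ext fun v => ?_
    obtain ⟨⟨x, y⟩, rfl⟩ := e.surjective v
    simp [LinearEquiv.conj_apply, e, Subrepresentation.toRepresentation]
  have ht := LinearMap.congr_fun (LinearMap.trace_prodMap ℂ σ.toSubmodule τ.toSubmodule)
    (σ.toRepresentation g, τ.toRepresentation g)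
  simp only [LinearMap.comp_apply, LinearMap.prodMapLinear_apply, LinearMap.prodMap_apply,
    LinearMap.coprod_apply, LinearMap.id_apply] at ht
  simp only [character, Pi.add_apply]
  rw [key, LinearMap.trace_conj', ht]

theorem finrank_eq_add_of_isCompl {V : Type*} [AddCommGroup V] [Module ℂ V] [FiniteDimensional ℂ V]
    {ρ : Representation ℂ G V} {σ τ : Subrepresentation ρ} (h : IsCompl σ τ) :
    Module.finrank ℂ V = Module.finrank ℂ σ.toSubmodule + Module.finrank ℂ τ.toSubmodule :=
  (Submodule.finrank_add_eq_of_isCompl (char_eq_add_of_isCompl h).1).symm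

variable [Finite G]

theorem exists_disjoint_char_sub_eq (n : ℕ) {V W : Type u} [AddCommGroup V] [Module ℂ V]
    [FiniteDimensional ℂ V] [AddCommGroup W] [Module ℂ W] [FiniteDimensional ℂ W]
    (ρ : Representation ℂ G V) (σ : Representation ℂ G W) (hn : Module.finrank ℂ V = n) :
    ∃ (V' : Type u) (_ : AddCommGroup V') (_ : Module ℂ V') (_ : FiniteDimensional ℂ V')
      (W' : Type u) (_ : AddCommGroup W') (_ : Module ℂ W') (_ : FiniteDimensional ℂ W')
      (ρ' : Representation ℂ G V') (σ' : Representation ℂ G W'),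
      (∀ φ : IntertwiningMap ρ' σ', φ = 0) ∧
      ρ'.character - σ'.character = ρ.character - σ.character := by
  induction n using Nat.strong_induction_on generalizing V W with
  | _ n ih =>
  by_cases h0 : ∀ φ : IntertwiningMap ρ σ, φ = 0
  · exact ⟨V, _, _, inferInstance, W, _, _, inferInstance, ρ, σ, h0, rfl⟩
  push Not at h0
  obtain ⟨φ, hφ⟩ := h0
  obtain ⟨κ, hκ⟩ := exists_isCompl (φ.ker)
  obtain ⟨τ, hτ⟩ := exists_isCompl (φ.range)
  obtain ⟨hκc, hκχ⟩ := char_eq_add_of_isCompl hκ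
  obtain ⟨hτc, hτχ⟩ := char_eq_add_of_isCompl hτ
  have hdim := finrank_eq_add_of_isCompl hκ
  have hlt : Module.finrank ℂ φ.ker.toSubmodule < n := by
    rcases Nat.eq_zero_or_pos (Module.finrank ℂ κ.toSubmodule) with h | h
    · exfalso
      apply hφ
      have hb : κ.toSubmodule = ⊥ := Submodule.finrank_eq_zero.1 h
      have ht : φ.ker.toSubmodule = ⊤ := by
        have := hκc.sup_eq_top
        rwa [hb, sup_bot_eq] at this
      ext v
      have hv : v ∈ φ.ker.toSubmodule := ht ▸ Submodule.mem_top
      exact hv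
    · omega
  have hiso : κ.toRepresentation.character = φ.range.toRepresentation.character := by
    let f : κ.toSubmodule →ₗ[ℂ] φ.range.toSubmodule :=
      (φ.toLinearMap.comp κ.toSubmodule.subtype).codRestrict _ fun v => ⟨v, rfl⟩
    have hf : Function.Bijective f := by
      constructor
      · rw [← LinearMap.ker_eq_bot, LinearMap.ker_eq_bot']
        intro v hv
        have h1 : (v : V) ∈ φ.ker.toSubmodule := congrArg Subtype.val hv
        have h2 : (v : V) ∈ φ.ker.toSubmodule ⊓ κ.toSubmodule := ⟨h1, v.2⟩
        rw [hκc.inf_eq_bot] at h2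
        exact Subtype.ext h2
      · rintro ⟨w, v, rfl⟩
        obtain ⟨a, ha, b, hb, rfl⟩ := Submodule.mem_sup.1
          (hκc.sup_eq_top ▸ Submodule.mem_top : v ∈ φ.ker.toSubmodule ⊔ κ.toSubmodule)
        refine ⟨⟨b, hb⟩, Subtype.ext ?_⟩
        have ha' : φ.toLinearMap a = 0 := ha
        change φ.toLinearMap b = φ.toLinearMap (a + b)
        rw [map_add, ha', zero_add]
    refine char_iso (Representation.Equiv.mk (LinearEquiv.ofBijective f hf) fun g => ?_)
    ext v
    exact IntertwiningMap.isIntertwining _ _ φ g v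
  obtain ⟨V', _, _, _, W', _, _, _, ρ', σ', hd, hχ⟩ :=
    ih _ hlt φ.ker.toRepresentation τ.toRepresentation rfl
  refine ⟨V', _, _, ‹_›, W', _, _, ‹_›, ρ', σ', hd, ?_⟩
  rw [hχ, hκχ, hτχ, hiso]
  abel

theorem exists_irreducible_of_apply_ne_one {h : G} (n : ℕ) {V : Type u} [AddCommGroup V]
    [Module ℂ V] [FiniteDimensional ℂ V] (ρ : Representation ℂ G V) (hn : Module.finrank ℂ V = n)
    (hρ : ρ h ≠ 1) :
    ∃ (V' : Type u) (_ : AddCommGroup V') (_ : Module ℂ V') (_ : FiniteDimensional ℂ V')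
      (ρ' : Representation ℂ G V'), ρ'.IsIrreducible ∧ ρ' h ≠ 1 := by
  induction n using Nat.strong_induction_on generalizing V with
  | _ n ih =>
  by_cases hi : ∀ σ : Subrepresentation ρ, σ = ⊥ ∨ σ = ⊤
  · refine ⟨V, _, _, inferInstance, ρ, ?_, hρ⟩
    have : Nontrivial (Subrepresentation ρ) := by
      refine ⟨⊥, ⊤, fun hbt => hρ ?_⟩
      refine LinearMap.ext fun v => ?_
      have h0 : ∀ w : V, w = 0 := fun w => by
        have : w ∈ (⊤ : Subrepresentation ρ) := _root_.trivial
        rw [← hbt] at this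
        exact this
      rw [h0 (ρ h v), h0 ((1 : V →ₗ[ℂ] V) v)]
    exact { eq_bot_or_eq_top := hi }
  push Not at hi
  obtain ⟨σ, hσb, hσt⟩ := hi
  obtain ⟨τ, hc⟩ := exists_isCompl σ
  obtain ⟨hcs, -⟩ := char_eq_add_of_isCompl hc
  have hdim := finrank_eq_add_of_isCompl hc
  have hσ : 0 < Module.finrank ℂ σ.toSubmodule := by
    refine Nat.pos_of_ne_zero fun h0 => hσb ?_
    exact Subrepresentation.toSubmodule_injective (Submodule.finrank_eq_zero.1 h0)
  have hτ : 0 < Module.finrank ℂ τ.toSubmodule := by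
    refine Nat.pos_of_ne_zero fun h0 => hσt ?_
    have hb : τ.toSubmodule = ⊥ := Submodule.finrank_eq_zero.1 h0
    have := hcs.sup_eq_top
    rw [hb, sup_bot_eq] at this
    exact Subrepresentation.toSubmodule_injective this
  by_cases h1 : σ.toRepresentation h = 1
  · by_cases h2 : τ.toRepresentation h = 1
    · exfalso
      apply hρ
      refine LinearMap.ext fun v => ?_
      obtain ⟨a, ha, b, hb, rfl⟩ := Submodule.mem_sup.1
        (hcs.sup_eq_top ▸ Submodule.mem_top : v ∈ σ.toSubmodule ⊔ τ.toSubmodule)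
      have e1 : ρ h a = a := congrArg Subtype.val (LinearMap.congr_fun h1 ⟨a, ha⟩)
      have e2 : ρ h b = b := congrArg Subtype.val (LinearMap.congr_fun h2 ⟨b, hb⟩)
      simp [e1, e2]
    · exact ih _ (by omega) τ.toRepresentation rfl h2
  · exact ih _ (by omega) σ.toRepresentation rfl h1

theorem exists_irreducible_apply_ne_one {G : Type u} [Group G] [Finite G] {h : G} (hh : h ≠ 1) :
    ∃ (V : Type u) (_ : AddCommGroup V) (_ : Module ℂ V) (_ : FiniteDimensional ℂ V)
      (ρ : Representation ℂ G V), ρ.IsIrreducible ∧ ρ h ≠ 1 := by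
  refine exists_irreducible_of_apply_ne_one _ (Representation.leftRegular ℂ G) rfl fun h1 => hh ?_
  have := LinearMap.congr_fun h1 (MonoidAlgebra.single 1 1)
  have h2 : MonoidAlgebra.single h (1 : ℂ) = MonoidAlgebra.single 1 1 := by simpa using this
  have h3 := congrArg (fun f => MonoidAlgebra.coeff f h) h2
  by_contra h4
  simp [Ne.symm h4] at h3

theorem eq_one_of_char_eq_finrank {V : Type*} [AddCommGroup V] [Module ℂ V]
    [FiniteDimensional ℂ V] (ρ : Representation ℂ G V) (g : G)
    (h : ∀ x ∈ Subgroup.zpowers g, ρ.character x = Module.finrank ℂ V) : ρ g = 1 := by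
  classical
  have := Fintype.ofFinite (Subgroup.zpowers g)
  set σ : Representation ℂ (Subgroup.zpowers g) V := ρ.comp (Subgroup.zpowers g).subtype
  have hne : ((Nat.card (Subgroup.zpowers g) : ℕ) : ℂ) ≠ 0 := by
    exact_mod_cast Nat.card_pos.ne'
  have := invertibleOfNonzero hne
  have h1 := card_inv_mul_sum_char_eq_finrank σ
  have h2 : ∀ x, σ.character x = Module.finrank ℂ V := fun x => h x x.2
  simp only [h2, Finset.sum_const, Finset.card_univ, nsmul_eq_mul, ← Nat.card_eq_fintype_card,
    inv_mul_cancel_left₀ hne, Nat.cast_inj] at h1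
  have h3 : σ.invariants = ⊤ := Submodule.eq_top_of_finrank_eq h1.symm
  refine LinearMap.ext fun v => ?_
  have : v ∈ σ.invariants := h3 ▸ Submodule.mem_top
  exact this ⟨g, Subgroup.mem_zpowers g⟩
end Characters
end Representation

namespace Representation

theorem trace_pi_eq_sum {ι V : Type*} [Fintype ι] [DecidableEq ι] [AddCommGroup V] [Module ℂ V]
    [FiniteDimensional ℂ V] (f : (ι → V) →ₗ[ℂ] (ι → V)) :
    LinearMap.trace ℂ _ f =
      ∑ i, LinearMap.trace ℂ V (LinearMap.proj i ∘ₗ f ∘ₗ LinearMap.single ℂ (fun _ => V) i) := by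
  have h : f = ∑ i, (f ∘ₗ LinearMap.single ℂ (fun _ => V) i) ∘ₗ LinearMap.proj i := by
    refine LinearMap.ext fun v => ?_
    simp only [LinearMap.sum_apply, LinearMap.comp_apply, LinearMap.proj_apply, ← map_sum]
    congr 1
    exact (LinearMap.sum_single_apply (fun _ => V) v).symm
  conv_lhs => rw [h]
  rw [map_sum]
  exact Finset.sum_congr rfl fun i _ => LinearMap.trace_comp_comm' _ _

section Induced
variable {G : Type*} [Group G] (H : Subgroup G)

/-- The `H`-valued cocycle attached to the chosen coset representatives. -/
noncomputable def cosetCocycle (g : G) (c : G ⧸ H) : H :=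
  ⟨c.out⁻¹ * g * (g⁻¹ • c).out, by
    have h : c = ((g * (g⁻¹ • c).out : G) : G ⧸ H) := by
      have := MulAction.Quotient.smul_mk H g (g⁻¹ • c).out
      rw [QuotientGroup.out_eq', smul_inv_smul] at this
      exact this
    have h2 : ((c.out : G) : G ⧸ H) = ((g * (g⁻¹ • c).out : G) : G ⧸ H) := by
      rw [← h]; exact QuotientGroup.out_eq' c
    rw [mul_assoc]
    exact QuotientGroup.eq.1 h2⟩

/-- The representation induced from a subgroup, written on functions on the coset space. -/
noncomputable def cosetInd {V : Type*} [AddCommGroup V] [Module ℂ V] (θ : Representation ℂ H V) :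
    Representation ℂ G (G ⧸ H → V) where
  toFun g := LinearMap.pi fun c => θ (cosetCocycle H g c) ∘ₗ LinearMap.proj (g⁻¹ • c)
  map_one' := by
    refine LinearMap.ext fun F => funext fun c => ?_
    have : cosetCocycle H 1 c = 1 := Subtype.ext (by simp [cosetCocycle])
    simp [this]
  map_mul' g g' := by
    refine LinearMap.ext fun F => funext fun c => ?_
    have : cosetCocycle H (g * g') c = cosetCocycle H g c * cosetCocycle H g' (g⁻¹ • c) :=
      Subtype.ext (by simp [cosetCocycle, mul_smul, mul_assoc])
    simp [this, mul_smul]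

open Classical in
/-- Extension of a function on a subgroup by zero. -/
noncomputable def extendByZero (χ : H → ℂ) (g : G) : ℂ := if hg : g ∈ H then χ ⟨g, hg⟩ else 0

theorem char_cosetInd [Finite G] [Fintype (G ⧸ H)] {V : Type*} [AddCommGroup V] [Module ℂ V]
    [FiniteDimensional ℂ V] (θ : Representation ℂ H V) (g : G) :
    (cosetInd H θ).character g =
      ∑ c : G ⧸ H, extendByZero H θ.character (c.out⁻¹ * g * c.out) := by
  classical
  rw [character, trace_pi_eq_sum]
  refine Finset.sum_congr rfl fun c _ => ?_
  have hiff : c.out⁻¹ * g * c.out ∈ H ↔ g⁻¹ • c = c := by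
    rw [inv_smul_eq_iff]
    conv_rhs => rw [← QuotientGroup.out_eq' c, MulAction.Quotient.smul_mk, QuotientGroup.eq]
    rw [smul_eq_mul, mul_assoc]
  by_cases hc : g⁻¹ • c = c
  · have hm := hiff.2 hc
    rw [extendByZero, dif_pos hm, character]
    congr 1
    refine LinearMap.ext fun v => ?_
    have : cosetCocycle H g c = ⟨_, hm⟩ := Subtype.ext (by simp [cosetCocycle, hc])
    simp [cosetInd, this, hc]
  · rw [extendByZero, dif_neg (mt hiff.1 hc)]
    convert LinearMap.map_zero _
    refine LinearMap.ext fun v => ?_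
    simp [cosetInd, hc]
end Induced

end Representation

namespace Representation

theorem exists_char_eq_of_sum_eq {G : Type u} [Group G] [Finite G] [Fintype G] {V W : Type u}
    [AddCommGroup V] [Module ℂ V] [FiniteDimensional ℂ V] [AddCommGroup W] [Module ℂ W]
    [FiniteDimensional ℂ W] (ρ : Representation ℂ G V) (σ : Representation ℂ G W) (d : ℕ)
    (hone : (ρ.character - σ.character) 1 = d)
    (hsum : ∑ g, (ρ.character - σ.character) g * (ρ.character - σ.character) g⁻¹ = Nat.card G) :
    ∃ (V' : Type u) (_ : AddCommGroup V') (_ : Module ℂ V') (_ : FiniteDimensional ℂ V')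
      (ρ' : Representation ℂ G V'), ρ'.character = ρ.character - σ.character := by
  obtain ⟨V', _, _, _, W', _, _, _, ρ', σ', h0, hχ⟩ := exists_disjoint_char_sub_eq _ ρ σ rfl
  rw [← hχ] at hone hsum ⊢
  have hne : ((Nat.card G : ℕ) : ℂ) ≠ 0 := by exact_mod_cast Nat.card_pos.ne'
  have := invertibleOfNonzero hne
  have a1 := card_inv_mul_sum_char_mul_char_eq_finrank ρ' ρ'
  have a2 := card_inv_mul_sum_char_mul_char_eq_finrank σ' σ'
  have a3 := card_inv_mul_sum_char_mul_char_eq_finrank ρ' σ'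
  have : Subsingleton (IntertwiningMap ρ' σ') := ⟨fun a b => by rw [h0 a, h0 b]⟩
  rw [Module.finrank_zero_of_subsingleton, Nat.cast_zero] at a3
  have a4 : ∑ g, σ'.character g * ρ'.character g⁻¹ = 0 := by
    simpa [hne] using a3
  have a5 : ∑ g, ρ'.character g * σ'.character g⁻¹ = 0 := by
    rw [← a4]
    refine Fintype.sum_equiv (Equiv.inv G) _ _ fun g => ?_
    simp [mul_comm]
  have hs : ∑ g, (ρ'.character - σ'.character) g * (ρ'.character - σ'.character) g⁻¹ =
      ∑ g, ρ'.character g * ρ'.character g⁻¹ + ∑ g, σ'.character g * σ'.character g⁻¹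
      - ∑ g, σ'.character g * ρ'.character g⁻¹ - ∑ g, ρ'.character g * σ'.character g⁻¹ := by
    simp only [← Finset.sum_add_distrib, ← Finset.sum_sub_distrib, Pi.sub_apply]
    exact Finset.sum_congr rfl fun g _ => by ring
  have a6 : (Module.finrank ℂ (IntertwiningMap ρ' ρ') : ℂ) +
      Module.finrank ℂ (IntertwiningMap σ' σ') = 1 := by
    rw [← a1, ← a2, ← mul_add]
    rw [hs, a4, a5, sub_zero, sub_zero] at hsum
    rw [hsum, inv_mul_cancel₀ hne]
  have a7 : Module.finrank ℂ (IntertwiningMap ρ' ρ') +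
      Module.finrank ℂ (IntertwiningMap σ' σ') = 1 := by exact_mod_cast a6
  have key : ∀ {U : Type u} [AddCommGroup U] [Module ℂ U] [FiniteDimensional ℂ U]
      (τ : Representation ℂ G U), Module.finrank ℂ (IntertwiningMap τ τ) = 0 →
        Module.finrank ℂ U = 0 := by
    intro U _ _ _ τ hτ
    have := Module.finrank_zero_iff.1 hτ
    have hid : IntertwiningMap.id τ = 0 := Subsingleton.elim _ _
    have : Subsingleton U := ⟨fun a b => by
      have ha : IntertwiningMap.id τ a = (0 : IntertwiningMap τ τ) a := by rw [hid]
      have hb : IntertwiningMap.id τ b = (0 : IntertwiningMap τ τ) b := by rw [hid]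
      simp at ha hb
      rw [ha, hb]⟩
    exact Module.finrank_zero_of_subsingleton
  have hW : Module.finrank ℂ W' = 0 := by
    rcases Nat.eq_zero_or_pos (Module.finrank ℂ (IntertwiningMap σ' σ')) with h | h
    · exact key σ' h
    · have hV := key ρ' (by omega)
      rw [Pi.sub_apply, char_one, char_one, hV, Nat.cast_zero, zero_sub] at hone
      have h2 : (d : ℂ) + Module.finrank ℂ W' = 0 := by rw [← hone]; ring
      have h3 : d + Module.finrank ℂ W' = 0 := by exact_mod_cast h2
      omega
  refine ⟨V', _, _, ‹_›, ρ', ?_⟩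
  have : Subsingleton W' := Module.finrank_zero_iff.1 hW
  funext g
  have : σ' g = 0 := Subsingleton.elim _ _
  simp [character, this]

section Frobenius
variable {G : Type u} [Group G] {H : Subgroup G}

theorem extendByZero_conj_eq_zero
    (hM : ∀ x : G, x ∉ H → ∀ g : G, g ∈ H → x * g * x⁻¹ ∈ H → g = 1)
    (ψ : H → ℂ) (hψ : ψ 1 = 0) {h x : G} (hh : h ∈ H) (hx : x ∉ H) :
    extendByZero H ψ (x⁻¹ * h * x) = 0 := by
  by_cases hm : x⁻¹ * h * x ∈ H
  · have h1 := hM x⁻¹ (fun h => hx (by simpa using H.inv_mem h)) h hh (by simpa using hm)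
    subst h1
    rw [mul_one, inv_mul_cancel, extendByZero, dif_pos H.one_mem]
    exact hψ
  · rw [extendByZero, dif_neg hm]

theorem exists_char_extension [Finite G]
    (hM : ∀ x : G, x ∉ H → ∀ g : G, g ∈ H → x * g * x⁻¹ ∈ H → g = 1)
    {V : Type u} [AddCommGroup V] [Module ℂ V] [FiniteDimensional ℂ V]
    (θ : Representation ℂ H V) (hθ : θ.IsIrreducible) (hnt : θ ≠ 1) :
    ∃ (V' : Type u) (_ : AddCommGroup V') (_ : Module ℂ V') (_ : FiniteDimensional ℂ V')
      (ρ : Representation ℂ G V'), (∀ h : H, ρ.character h = θ.character h) ∧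
      ∀ g, (∀ x : G, x⁻¹ * g * x ∉ H) → ρ.character g = Module.finrank ℂ V := by
  classical
  have := Fintype.ofFinite G
  set d := Module.finrank ℂ V
  set ψ : H → ℂ := fun h => θ.character h - d with hψ
  have hψ1 : ψ 1 = 0 := by simp [hψ, d]
  have hψc : ∀ h k : H, ψ (k⁻¹ * h * k) = ψ h := fun h k => by
    have := char_conj θ h k⁻¹
    simp only [inv_inv] at this
    simp only [hψ, this]
  set σ := (cosetInd H θ).prod (Representation.trivial ℂ G V)
  set τ := cosetInd H (Representation.trivial ℂ H V)
  set f := σ.character - τ.character with hf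
  have hfval : ∀ g, f g = d + ∑ c : G ⧸ H, extendByZero H ψ (c.out⁻¹ * g * c.out) := by
    intro g
    have ht := LinearMap.congr_fun (LinearMap.trace_prodMap ℂ (G ⧸ H → V) V)
      (cosetInd H θ g, Representation.trivial ℂ G V g)
    simp only [LinearMap.comp_apply, LinearMap.prodMapLinear_apply, LinearMap.prodMap_apply,
      LinearMap.coprod_apply, LinearMap.id_apply] at ht
    have h1 : σ.character g = (cosetInd H θ).character g + d := by
      rw [character]
      refine ht.trans ?_
      congr 1
      have : Representation.trivial ℂ G V g = 1 := rfl
      rw [this, LinearMap.trace_one]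
    rw [hf, Pi.sub_apply, h1, char_cosetInd, char_cosetInd, add_comm, add_sub_assoc,
      ← Finset.sum_sub_distrib]
    congr 1
    refine Finset.sum_congr rfl fun c _ => ?_
    rw [extendByZero, extendByZero, extendByZero]
    split_ifs with hm
    · simp only [hψ]
      congr 1
      have : (Representation.trivial ℂ H V) ⟨_, hm⟩ = 1 := rfl
      rw [character, this, LinearMap.trace_one]
    · simp
  have hfH : ∀ h : H, f h = θ.character h := by
    intro h
    have hs : ∑ c : G ⧸ H, extendByZero H ψ (c.out⁻¹ * h * c.out) = ψ h := by
      have hout : ((1 : G) : G ⧸ H).out ∈ H := by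
        have := QuotientGroup.out_eq' ((1 : G) : G ⧸ H)
        simpa using QuotientGroup.eq.1 this
      rw [Finset.sum_eq_single ((1 : G) : G ⧸ H)]
      · have hm : ((1 : G) : G ⧸ H).out⁻¹ * h * ((1 : G) : G ⧸ H).out ∈ H :=
          H.mul_mem (H.mul_mem (H.inv_mem hout) h.2) hout
        rw [extendByZero, dif_pos hm, ← hψc h ⟨_, hout⟩]
        rfl
      · intro c _ hc
        refine extendByZero_conj_eq_zero hM ψ hψ1 h.2 fun hco => hc ?_
        rw [← QuotientGroup.out_eq' c]
        exact QuotientGroup.eq.2 (by simpa using hco)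
      · simp
    rw [hfval, hs, hψ]
    ring
  have hfK : ∀ g, (∀ x : G, x⁻¹ * g * x ∉ H) → f g = d := by
    intro g hg
    rw [hfval, Finset.sum_eq_zero, add_zero]
    intro c _
    rw [extendByZero, dif_neg (hg _)]
  have hfconj : ∀ g x, f (x⁻¹ * g * x) = f g := fun g x => by
    have h1 := char_conj σ g x⁻¹
    have h2 := char_conj τ g x⁻¹
    simp only [inv_inv] at h1 h2
    simp only [hf, Pi.sub_apply, h1, h2]
  have hpair : ∀ F : G → ℂ, (∀ g x, F (x⁻¹ * g * x) = F g) →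
      ∑ g, f g * F g = d * ∑ g, F g + Nat.card (G ⧸ H) * ∑ h : H, ψ h * F h := by
    intro F hF
    have hc : ∀ c : G ⧸ H, ∑ g, extendByZero H ψ (c.out⁻¹ * g * c.out) * F g =
        ∑ h : H, ψ h * F h := by
      intro c
      have e1 : ∑ g, extendByZero H ψ (c.out⁻¹ * g * c.out) * F g =
          ∑ g, extendByZero H ψ g * F g := by
        refine Fintype.sum_equiv (MulAut.conj c.out⁻¹).toEquiv _ _ fun g => ?_
        simp [hF]
      rw [e1]
      have e2 : ∀ h : H, ψ h * F h = extendByZero H ψ h * F h := fun h => by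
        rw [extendByZero, dif_pos h.2]
      simp only [e2]
      rw [← Finset.sum_subtype (Finset.univ.filter (· ∈ H)) (by simp)
        (fun g => extendByZero H ψ g * F g)]
      refine (Finset.sum_subset (Finset.subset_univ _) fun g _ hg => ?_).symm
      rw [extendByZero, dif_neg (by simpa using hg), zero_mul]
    simp only [hfval, add_mul, Finset.sum_add_distrib, Finset.mul_sum, Finset.sum_mul]
    congr 1
    rw [Finset.sum_comm]
    simp only [hc, Finset.sum_const, Finset.card_univ, nsmul_eq_mul, Nat.card_eq_fintype_card,
      Finset.mul_sum]
  have hm : (Nat.card (G ⧸ H) : ℂ) * Nat.card H = Nat.card G := by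
    rw [Subgroup.card_eq_card_quotient_mul_card_subgroup H]; push_cast; rfl
  have hneH : ((Nat.card H : ℕ) : ℂ) ≠ 0 := by exact_mod_cast Nat.card_pos.ne'
  have := invertibleOfNonzero hneH
  have hθ0 : ∑ h, θ.character h = 0 := by
    have h1 := card_inv_mul_sum_char_eq_finrank θ
    let I : Subrepresentation θ := ⟨θ.invariants, fun g v hv => by rwa [hv g]⟩
    have h2 : θ.invariants = ⊥ := by
      rcases eq_bot_or_eq_top I with h | h
      · exact congrArg Subrepresentation.toSubmodule h
      · refine absurd ?_ hnt
        have h3 : θ.invariants = ⊤ := congrArg Subrepresentation.toSubmodule h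
        refine MonoidHom.ext fun g => LinearMap.ext fun v => ?_
        have : v ∈ θ.invariants := h3 ▸ Submodule.mem_top
        exact this g
    rw [h2, finrank_bot, Nat.cast_zero] at h1
    simpa [hneH] using h1
  have hθ1 : ∑ h, θ.character h * θ.character h⁻¹ = Nat.card H := by
    have h1 := char_orthonormal θ θ
    rw [if_pos ⟨Equiv.refl θ⟩, inv_mul_eq_iff_eq_mul₀ hneH, mul_one] at h1
    exact h1
  have hψsum : ∑ h : H, ψ h = - (d * Nat.card H) := by
    simp [hψ, hθ0, mul_comm]
  have hfsum : ∑ g, f g = 0 := by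
    have := hpair (fun _ => 1) (fun _ _ => rfl)
    simp only [mul_one, Finset.sum_const, Finset.card_univ, nsmul_eq_mul, hψsum,
      ← Nat.card_eq_fintype_card, ← hm] at this
    rw [this]; ring
  have hfinv : ∑ g, f g⁻¹ = 0 := by
    rw [← hfsum]; exact Fintype.sum_equiv (Equiv.inv G) _ _ fun g => rfl
  have hθinv : ∑ h, θ.character h⁻¹ = 0 := by
    rw [← hθ0]; exact Fintype.sum_equiv (Equiv.inv H) _ _ fun g => rfl
  have hff : ∑ g, f g * f g⁻¹ = Nat.card G := by
    rw [hpair (fun g => f g⁻¹) (fun g x => by rw [← hfconj g⁻¹ x]; congr 1; group), hfinv, ← hm,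
      mul_zero, zero_add]
    congr 1
    have : ∀ h : H, ψ h * f (h : G)⁻¹ =
        θ.character h * θ.character h⁻¹ - d * θ.character h⁻¹ := fun h => by
      rw [← hfH h⁻¹, hψ, Subgroup.coe_inv]; ring
    simp only [this, Finset.sum_sub_distrib, ← Finset.mul_sum, hθ1, hθinv]
    ring
  obtain ⟨V', _, _, _, ρ, hρ⟩ := exists_char_eq_of_sum_eq σ τ d
    (by simpa only [OneMemClass.coe_one, char_one] using hfH 1) hff
  exact ⟨V', _, _, ‹_›, ρ, fun h => hρ ▸ hfH h, fun g hg => hρ ▸ hfK g hg⟩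

end Frobenius
end Representation

section Frobenius
variable {G : Type u} [Group G] [Finite G] {H : Subgroup G}

omit [Finite G] in
private theorem eq_one_of_conj_eq_one {x h : G} (hx : x⁻¹ * h * x = 1) : h = 1 := by
  calc h = x * (x⁻¹ * h * x) * x⁻¹ := by group
    _ = 1 := by rw [hx]; group

/-- A finite group is not the union of the conjugates of a proper subgroup. -/
theorem Subgroup.exists_forall_conj_notMem (htop : H ≠ ⊤) : ∃ g : G, ∀ x : G, x⁻¹ * g * x ∉ H := by
  by_contra! hall
  let F : (G ⧸ H) × H → G := fun p => p.1.out * p.2 * p.1.out⁻¹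
  have hF : Function.Surjective F := by
    intro g
    obtain ⟨x, hx⟩ := hall g
    have hk : (x : G ⧸ H).out⁻¹ * x ∈ H := QuotientGroup.eq.1 (QuotientGroup.out_eq' (x : G ⧸ H))
    refine ⟨(x, ⟨_, H.mul_mem (H.mul_mem hk hx) (H.inv_mem hk)⟩), ?_⟩
    simp only [F]
    group
  have hcard : Nat.card ((G ⧸ H) × H) = Nat.card G := by
    rw [Nat.card_prod, ← Subgroup.card_eq_card_quotient_mul_card_subgroup]
  have hinj := ((Nat.bijective_iff_surjective_and_card F).2 ⟨hF, hcard⟩).1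
  apply htop
  rw [Subgroup.eq_top_iff']
  intro x
  have h1 : F ((x : G ⧸ H), 1) = F (((1 : G) : G ⧸ H), 1) := by simp [F]
  have h2 := congrArg Prod.fst (hinj h1)
  simpa using QuotientGroup.eq.1 h2.symm

open Representation in
/-- **Frobenius' theorem**: a Frobenius group has a Frobenius kernel. -/
theorem IsFrobeniusGroup.exists_kernel (hG : IsFrobeniusGroup G) :
    ∃ N : Subgroup G, N.Normal ∧ N ≠ ⊥ ∧ N ≠ ⊤ ∧
      ∀ n ∈ N, n ≠ 1 → ∀ g, g * n = n * g → g ∈ N := by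
  obtain ⟨H, hbot, htop, hM⟩ := hG
  set K : Set G := {g | ∀ h ∈ Subgroup.zpowers g, h ≠ 1 → ∀ x : G, x⁻¹ * h * x ∉ H}
  set N := Subgroup.normalClosure K
  have hN : N.Normal := Subgroup.normalClosure_normal
  have hK : ∀ g, (∀ x : G, x⁻¹ * g * x ∉ H) → g ∈ K := by
    rintro g hg h ⟨i, rfl⟩ hh x hx
    refine hh (eq_one_of_conj_eq_one (x := x) ?_)
    refine hM _ (hg x) _ hx ?_
    convert hx using 1
    group
  have hNH : ∀ h ∈ N, h ∈ H → h = 1 := by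
    intro h hN hH
    by_contra hne
    obtain ⟨V, _, _, _, θ, hθ, hθh⟩ := exists_irreducible_apply_ne_one (h := (⟨h, hH⟩ : H))
      (fun h1 => hne (congrArg Subtype.val h1))
    obtain ⟨V', _, _, _, ρ, h1, h2⟩ := exists_char_extension hM θ hθ
      (fun h1 => hθh (by rw [h1]; rfl))
    have hdim : Module.finrank ℂ V' = Module.finrank ℂ V := by
      have := h1 1
      rw [OneMemClass.coe_one, char_one, char_one] at this
      exact_mod_cast this
    have hker : N ≤ MonoidHom.ker ρ := by
      refine Subgroup.normalClosure_le_normal fun g hg => ?_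
      refine eq_one_of_char_eq_finrank ρ g fun x hx => ?_
      by_cases hx1 : x = 1
      · rw [hx1, char_one]
      · rw [h2 x (hg x hx hx1), hdim]
    refine hθh (eq_one_of_char_eq_finrank θ _ fun x hx => ?_)
    obtain ⟨i, rfl⟩ := hx
    have h3 : ρ (h ^ i) = 1 := hker (N.zpow_mem hN i)
    have h4 : ρ.character (h ^ i) = Module.finrank ℂ V := by
      rw [character, h3, LinearMap.trace_one, hdim]
    rw [← h4, ← h1]
    rfl
  have hNH' : ∀ n ∈ N, n ≠ 1 → ∀ x : G, x⁻¹ * n * x ∉ H := by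
    intro n hn hn1 x hx
    have h1 := hN.conj_mem n hn x⁻¹
    rw [inv_inv] at h1
    have h2 := hNH _ h1 hx
    exact hn1 (eq_one_of_conj_eq_one h2)
  refine ⟨N, hN, ?_, ?_, ?_⟩
  · intro hb
    obtain ⟨g, hg⟩ := Subgroup.exists_forall_conj_notMem htop
    have h1 : g ∈ N := Subgroup.subset_normalClosure (hK g hg)
    rw [hb, Subgroup.mem_bot] at h1
    exact hg 1 (by simp [h1])
  · intro ht
    refine hbot (eq_bot_iff.2 fun h hh => hNH h (ht ▸ Subgroup.mem_top h) hh)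
  · intro n hn hn1 g hg
    by_contra hgN
    have hgK : ¬ ∀ x : G, x⁻¹ * g * x ∉ H := fun h =>
      hgN (Subgroup.subset_normalClosure (hK g h))
    push Not at hgK
    obtain ⟨x, hx⟩ := hgK
    have h1 := hNH' n hn hn1 x
    have h2 := hM _ h1 _ hx (by
      have : x⁻¹ * n * x * (x⁻¹ * g * x) * (x⁻¹ * n * x)⁻¹ = x⁻¹ * g * x := by
        have : n * g * n⁻¹ = g := by rw [← hg]; group
        calc _ = x⁻¹ * (n * g * n⁻¹) * x := by group
          _ = _ := by rw [this]
      rwa [this])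
    apply hgN
    rw [eq_one_of_conj_eq_one h2]
    exact N.one_mem
end Frobenius

/-- A multiplicative action of a group on a ring is free if nonidentity elements fix only `0`. -/
def MonoidHom.ActsFreely {X E : Type*} [Group X] [Ring E] (ρ : X →* E) : Prop :=
  ∀ h : X, h ≠ 1 → ∀ e : E, ρ h * e = e → e = 0

namespace MonoidHom.ActsFreely

section
variable {X E : Type*} [Group X] [Ring E] {ρ : X →* E}

theorem sum_pow_eq_zero (hρ : ρ.ActsFreely) {h : X} (hh : h ≠ 1) {n : ℕ} (hn : h ^ n = 1) :
    ∑ i ∈ Finset.range n, ρ h ^ i = 0 := by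
  refine hρ h hh _ ?_
  have := mul_geom_sum (ρ h) n
  rw [← map_pow, hn, map_one, sub_self, sub_mul, one_mul, sub_eq_zero] at this
  exact this

theorem injective [Nontrivial E] (hρ : ρ.ActsFreely) : Function.Injective ρ := by
  rw [injective_iff_map_eq_one]
  intro a ha
  by_contra hne
  exact one_ne_zero (hρ a hne 1 (by rw [ha, one_mul]))

theorem map_eq_neg_one (hρ : ρ.ActsFreely) {t : X} (ht : t ≠ 1) (ht2 : t ^ 2 = 1) : ρ t = -1 := by
  have := hρ.sum_pow_eq_zero ht ht2
  rw [Finset.sum_range_succ, Finset.sum_range_one, pow_zero, pow_one] at this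
  rwa [← eq_neg_iff_add_eq_zero, eq_comm, neg_eq_iff_eq_neg] at this

theorem eq_of_sq_eq_one [Nontrivial E] (hρ : ρ.ActsFreely) {s t : X} (hs : s ≠ 1)
    (hs2 : s ^ 2 = 1) (ht : t ≠ 1) (ht2 : t ^ 2 = 1) : s = t :=
  hρ.injective (by rw [hρ.map_eq_neg_one hs hs2, hρ.map_eq_neg_one ht ht2])

theorem commute_of_sq_eq_one [Nontrivial E] (hρ : ρ.ActsFreely) {t : X} (ht : t ≠ 1)
    (ht2 : t ^ 2 = 1) (x : X) : t * x = x * t :=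
  hρ.injective (by rw [map_mul, map_mul, hρ.map_eq_neg_one ht ht2]; simp)

end
end MonoidHom.ActsFreely

section
variable {X E : Type*} [Group X] [Ring E] (ρ : X →* E)

theorem MonoidHom.map_eq_one_of_geom_sum_eq_zero (R : Subgroup X) [Finite R] {β : X} {n : ℕ}
    (hn : 0 < n)
    (hsum : ∑ i ∈ Finset.range n, ρ β ^ i = 0) (hnorm : ∀ s ∈ R, β * s * β⁻¹ ∈ R)
    (hsurj : ∀ i, 0 < i → i < n → ∀ r ∈ R, ∃ s ∈ R, r = s * β ^ i * s⁻¹ * (β ^ i)⁻¹)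
    (hc : ∀ e : E, (Nat.card R : E) * e = 0 → e = 0) {r : X} (hr : r ∈ R) : ρ r = 1 := by
  classical
  have := Fintype.ofFinite R
  set S : E := ∑ s : R, ρ s with hS
  have hnorm' : ∀ i : ℕ, ∀ s ∈ R, β ^ i * s * (β ^ i)⁻¹ ∈ R := by
    intro i
    induction i with
    | zero => simp
    | succ i ih =>
      intro s hs
      have := hnorm _ (ih s hs)
      convert this using 1
      rw [pow_succ']
      group
  have hi : ∀ i, 0 < i → i < n → ∑ s : R, ρ s * ρ β ^ i * ρ (s⁻¹ : X) = S * ρ β ^ i := by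
    intro i h0 hin
    let f : R → R := fun s => ⟨s * (β ^ i * s⁻¹ * (β ^ i)⁻¹),
      R.mul_mem s.2 (hnorm' i _ (R.inv_mem s.2))⟩
    have hf : Function.Surjective f := by
      rintro ⟨r, hr⟩
      obtain ⟨s, hs, rfl⟩ := hsurj i h0 hin r hr
      exact ⟨⟨s, hs⟩, Subtype.ext (by simp [f, mul_assoc])⟩
    have hbij : Function.Bijective f := Finite.surjective_iff_bijective.1 hf
    rw [hS, Finset.sum_mul, ← hbij.sum_comp (fun s : R => ρ s * ρ β ^ i)]
    refine Finset.sum_congr rfl fun s _ => ?_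
    rw [← map_pow, ← map_mul, ← map_mul, ← map_mul]
    congr 1
    simp [f, mul_assoc]
  have hsplit : ∑ i ∈ (Finset.range n).erase 0, ρ β ^ i = -1 := by
    have := Finset.add_sum_erase (Finset.range n) (fun i => ρ β ^ i) (Finset.mem_range.2 hn)
    rw [hsum, pow_zero] at this
    rw [eq_neg_iff_add_eq_zero, add_comm, this]
  have h0 : ∑ s : R, ρ s * (∑ i ∈ Finset.range n, ρ β ^ i) * ρ (s⁻¹ : X) = 0 := by
    simp [hsum]
  have h1 : ∑ s : R, ρ s * (∑ i ∈ Finset.range n, ρ β ^ i) * ρ (s⁻¹ : X) =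
      Nat.card R - S := by
    simp only [Finset.mul_sum, Finset.sum_mul]
    rw [Finset.sum_comm, ← Finset.add_sum_erase _ _ (Finset.mem_range.2 hn)]
    have h2 : ∑ i ∈ (Finset.range n).erase 0, ∑ s : R, ρ s * ρ β ^ i * ρ (s⁻¹ : X) =
        ∑ i ∈ (Finset.range n).erase 0, S * ρ β ^ i := by
      refine Finset.sum_congr rfl fun i hi' => ?_
      rw [Finset.mem_erase, Finset.mem_range] at hi'
      exact hi i (Nat.pos_of_ne_zero hi'.1) hi'.2
    rw [h2, ← Finset.mul_sum, hsplit]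
    simp [← map_mul, sub_eq_add_neg]
  have hS' : S = Nat.card R := by
    rw [h0] at h1
    exact (sub_eq_zero.1 h1.symm).symm
  have hrS : ρ r * S = S := by
    rw [hS, Finset.mul_sum]
    refine Fintype.sum_equiv (Equiv.mulLeft (⟨r, hr⟩ : R)) _ _ fun s => ?_
    simp
  refine sub_eq_zero.1 (hc _ ?_)
  rw [mul_sub, mul_one, sub_eq_zero, Nat.cast_comm, ← hS', hrS]
end

theorem mem_zpowers_of_prime_orderOf {X : Type*} [Group X] {q : ℕ} (hq : q.Prime) {c x : X}
    (hc : orderOf c = q) (hx : x ≠ 1) (hxc : x ∈ Subgroup.zpowers c) :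
    c ∈ Subgroup.zpowers x := by
  obtain ⟨i, rfl⟩ := hxc
  refine mem_zpowers_zpow_iff.2 ?_
  rw [hc, Int.gcd_comm]
  refine (hq.coprime_iff_not_dvd).2 fun hd => hx ?_
  have hd' : (orderOf c : ℤ) ∣ i := by rw [hc]; exact Int.natCast_dvd.2 hd
  exact orderOf_dvd_iff_zpow_eq_one.1 hd'

namespace MonoidHom.ActsFreely
variable {X E : Type*} [Group X] [Ring E] [Nontrivial E] {ρ : X →* E}

theorem mem_zpowers_of_commute (hρ : ρ.ActsFreely)
    (hc : ∀ e : E, (Nat.card X : E) * e = 0 → e = 0) {p : ℕ} (hp : p.Prime) {a b : X}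
    (ha : orderOf a = p) (hb : b ^ p = 1) (hab : Commute a b) : b ∈ Subgroup.zpowers a := by
  by_contra hnot
  have h1 : ∀ i : ℕ, ∑ j ∈ Finset.range p, ρ (a ^ i * b) ^ j = 0 := by
    intro i
    refine hρ.sum_pow_eq_zero (fun h => hnot ?_) ?_
    · rw [eq_inv_of_mul_eq_one_right h]
      exact Subgroup.inv_mem _ (Subgroup.pow_mem _ (Subgroup.mem_zpowers a) i)
    · rw [(hab.pow_left i).mul_pow, hb, mul_one, ← pow_mul, mul_comm i, pow_mul, ← ha,
        pow_orderOf_eq_one, one_pow]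
  have h2 : ∑ j ∈ Finset.range p, ∑ i ∈ Finset.range p, ρ (a ^ i * b) ^ j = 0 := by
    rw [Finset.sum_comm]
    exact Finset.sum_eq_zero fun i _ => h1 i
  rw [← Finset.add_sum_erase _ _ (Finset.mem_range.2 hp.pos),
    add_eq_left.2 (Finset.sum_eq_zero ?_)] at h2
  · simp only [pow_zero, Finset.sum_const, Finset.card_range, nsmul_eq_mul, mul_one] at h2
    refine one_ne_zero (hc 1 ?_)
    obtain ⟨k, hk⟩ : p ∣ Nat.card X := ha ▸ orderOf_dvd_natCard a
    rw [hk, Nat.cast_mul, h2, zero_mul, zero_mul]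
  · intro j hj
    rw [Finset.mem_erase, Finset.mem_range] at hj
    have h3 : ∀ i, ρ (a ^ i * b) ^ j = ρ (a ^ j) ^ i * ρ (b ^ j) := fun i => by
      rw [← map_pow, ← map_pow, ← map_mul, (hab.pow_left i).mul_pow, ← pow_mul, ← pow_mul,
        mul_comm i]
    simp only [h3, ← Finset.sum_mul]
    rw [hρ.sum_pow_eq_zero, zero_mul]
    · intro h
      have := orderOf_dvd_of_pow_eq_one h
      rw [ha] at this
      exact absurd (Nat.le_of_dvd (Nat.pos_of_ne_zero hj.1) this) (by omega)
    · rw [← pow_mul, mul_comm, pow_mul, ← ha, pow_orderOf_eq_one, one_pow]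

theorem commute_of_normalizes [Finite X] (hρ : ρ.ActsFreely)
    (hc : ∀ e : E, (Nat.card X : E) * e = 0 → e = 0) {p l : ℕ} (hp : p.Prime) (hl : l.Prime)
    {a y : X} (ha : orderOf a = p) (hy : orderOf y = l)
    (hay : y * a * y⁻¹ ∈ Subgroup.zpowers a) : Commute a y := by
  by_contra hnot
  have hy1 : y ≠ 1 := fun h => by rw [h, orderOf_one] at hy; exact hl.one_lt.ne hy
  have ha1 : a ≠ 1 := fun h => by rw [h, orderOf_one] at ha; exact hp.one_lt.ne ha
  have hnorm : ∀ s ∈ Subgroup.zpowers a, y * s * y⁻¹ ∈ Subgroup.zpowers a := by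
    rintro _ ⟨i, rfl⟩
    have := Subgroup.zpow_mem _ hay i
    rwa [← conj_zpow] at *
  have hnorm' : ∀ i : ℕ, ∀ s ∈ Subgroup.zpowers a, y ^ i * s * (y ^ i)⁻¹ ∈ Subgroup.zpowers a := by
    intro i
    induction i with
    | zero => simp
    | succ i ih =>
      intro s hs
      have := hnorm _ (ih s hs)
      convert this using 1
      rw [pow_succ']
      group
  have hfix : ∀ i, 0 < i → i < l → ∀ s ∈ Subgroup.zpowers a, Commute s (y ^ i) → s = 1 := by
    intro i h0 hil s hs hcomm
    by_contra hs1
    apply hnot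
    obtain ⟨m, hm⟩ := mem_zpowers_of_prime_orderOf hp ha hs1 hs
    obtain ⟨k, hk⟩ := mem_zpowers_of_prime_orderOf (x := y ^ i) hl hy (fun h => by
      have := orderOf_dvd_of_pow_eq_one h
      rw [hy] at this
      exact absurd (Nat.le_of_dvd h0 this) (by omega)) (Subgroup.pow_mem _ (Subgroup.mem_zpowers y) i)
    rw [← hm, ← hk]
    exact (hcomm.zpow_left m).zpow_right k
  refine ha1 (hρ.injective ?_)
  rw [map_one]
  refine ρ.map_eq_one_of_geom_sum_eq_zero (Subgroup.zpowers a) hl.pos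
    (hρ.sum_pow_eq_zero hy1 (hy ▸ pow_orderOf_eq_one y)) hnorm ?_ ?_ (Subgroup.mem_zpowers a)
  · intro i h0 hil r hr
    let f : Subgroup.zpowers a → Subgroup.zpowers a := fun s => ⟨s * (y ^ i * s⁻¹ * (y ^ i)⁻¹),
      Subgroup.mul_mem _ s.2 (hnorm' i _ (Subgroup.inv_mem _ s.2))⟩
    have hf : Function.Injective f := by
      intro s t hst
      have h1 : (s : X) * (y ^ i * (s : X)⁻¹ * (y ^ i)⁻¹) = t * (y ^ i * (t : X)⁻¹ * (y ^ i)⁻¹) :=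
        congrArg Subtype.val hst
      have h2 : ((t : X)⁻¹ * s) = 1 := by
        refine hfix i h0 hil _ (Subgroup.mul_mem _ (Subgroup.inv_mem _ t.2) s.2) ?_
        have h3 : (s : X) * y ^ i * (s : X)⁻¹ = t * y ^ i * (t : X)⁻¹ := by
          simpa [← mul_assoc] using h1
        show (t : X)⁻¹ * s * y ^ i = y ^ i * ((t : X)⁻¹ * s)
        calc (t : X)⁻¹ * s * y ^ i = (t : X)⁻¹ * ((s : X) * y ^ i * (s : X)⁻¹) * s := by group
          _ = _ := by rw [h3]; group
      exact Subtype.ext (inv_mul_eq_one.1 h2).symm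
    obtain ⟨s, hs⟩ := (Finite.injective_iff_surjective.1 hf) ⟨r, hr⟩
    refine ⟨s, s.2, ?_⟩
    have hs' : (s : X) * (y ^ i * (s : X)⁻¹ * (y ^ i)⁻¹) = r := congrArg Subtype.val hs
    rw [← hs']
    simp [mul_assoc]
  · intro e he
    refine hc e ?_
    obtain ⟨k, hk⟩ := Subgroup.card_subgroup_dvd_card (Subgroup.zpowers a)
    rw [hk, mul_comm, Nat.cast_mul, mul_assoc, he, mul_zero]

end MonoidHom.ActsFreely

theorem IsCutGroup.exists_conj_eq_zpow {X : Type*} [Group X] (hcut : IsCutGroup X) (x : X) (k : ℤ)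
    (hk : Int.gcd k (orderOf x) = 1) : ∃ d : X, d * x * d⁻¹ = x ^ k ∨ d * x * d⁻¹ = x ^ (-k) := by
  rcases hcut x k hk with h | h
  · obtain ⟨c, hc⟩ := isConj_iff.1 h.symm
    exact ⟨c, Or.inl hc⟩
  · obtain ⟨c, hc⟩ := isConj_iff.1 h.symm
    refine ⟨c, Or.inr ?_⟩
    rw [zpow_neg, ← hc]
    group

theorem IsCutGroup.of_surjective {X Y : Type*} [Group X] [Finite X] [Group Y]
    (hcut : IsCutGroup X) (f : X →* Y) (hf : Function.Surjective f) : IsCutGroup Y := by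
  intro y k hk
  obtain ⟨x, rfl⟩ := hf y
  have hdvd : orderOf (f x) ∣ orderOf x := orderOf_map_dvd f x
  have hpos := orderOf_pos x
  have : NeZero (orderOf x) := ⟨hpos.ne'⟩
  obtain ⟨u, hu⟩ := ZMod.unitsMap_surjective hdvd
    (ZMod.unitOfIsCoprime k (Int.isCoprime_iff_gcd_eq_one.2 hk))
  obtain ⟨m, hm⟩ := ZMod.intCast_surjective (u : ZMod (orderOf x))
  have hgcd : Int.gcd m (orderOf x) = 1 := by
    rw [← Int.isCoprime_iff_gcd_eq_one]
    exact ((ZMod.coe_int_isUnit_iff_isCoprime m _).1 (hm ▸ u.isUnit)).symm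
  have hkm : f x ^ k = f x ^ m := by
    rw [zpow_eq_zpow_iff_modEq, ← ZMod.intCast_eq_intCast_iff]
    have := congrArg Units.val hu
    rw [ZMod.coe_unitOfIsCoprime] at this
    rw [← this, ZMod.unitsMap_val, ← hm]
    exact ZMod.cast_intCast hdvd m
  rw [hkm, ← map_zpow, ← map_inv]
  exact (hcut x m hgcd).imp (fun h => f.map_isConj h) (fun h => f.map_isConj h)

theorem MulAut.pow_apply_eq_zpow {A X : Type*} [Group A] [Group X] (φ : X →* MulAut A) {h : X}
    {v : A} {σ : ℤ} (hσ : φ h v = v ^ σ) (n : ℕ) : φ (h ^ n) v = v ^ σ ^ n := by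
  induction n with
  | zero => simp
  | succ n ih => rw [pow_succ', map_mul, MulAut.mul_apply, ih, map_zpow, hσ, ← zpow_mul, pow_succ']

theorem exists_apply_eq_zpow_of_cut {A X : Type*} [Group A] [Group X] (φ : X →* MulAut A) {v : A}
    {q : ℕ} (hq : q.Prime) (hv : orderOf v = q)
    (hcut : ∀ k : ℤ, Int.gcd k q = 1 → ∃ h, φ h v = v ^ k ∨ φ h v = v ^ (-k)) :
    ∃ h, ∃ σ : ℤ, φ h v = v ^ σ ∧
      ∀ n : ℕ, φ (h ^ n) v = v → q - 1 ∣ 2 * n ∧ (4 ∣ q - 1 → q - 1 ∣ n) := by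
  have := Fact.mk hq
  obtain ⟨g, hg⟩ := IsCyclic.exists_generator (α := (ZMod q)ˣ)
  have hg' : orderOf g = q - 1 := by
    rw [orderOf_eq_card_of_forall_mem_zpowers hg, Nat.card_eq_fintype_card, ZMod.card_units]
  obtain ⟨k, hk⟩ := ZMod.intCast_surjective (g : ZMod q)
  have hgcd : Int.gcd k q = 1 := by
    rw [← Int.isCoprime_iff_gcd_eq_one]
    exact ((ZMod.coe_int_isUnit_iff_isCoprime k _).1 (hk ▸ g.isUnit)).symm
  obtain ⟨h, hh⟩ := hcut k hgcd
  have hσ : ∃ σ : ℤ, φ h v = v ^ σ ∧ (σ = k ∨ σ = -k) := by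
    rcases hh with hh | hh
    exacts [⟨k, hh, Or.inl rfl⟩, ⟨-k, hh, Or.inr rfl⟩]
  obtain ⟨σ, hσ, hσk⟩ := hσ
  refine ⟨h, σ, hσ, fun n hn => ?_⟩
  rw [MulAut.pow_apply_eq_zpow φ hσ] at hn
  have h1 : (q : ℤ) ∣ σ ^ n - 1 := by
    rw [← hv, orderOf_dvd_iff_zpow_eq_one, zpow_sub, hn, zpow_one, mul_inv_cancel]
  have h2 : (σ : ZMod q) ^ n = 1 := by
    have := (ZMod.intCast_zmod_eq_zero_iff_dvd _ q).2 h1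
    push_cast at this
    exact sub_eq_zero.1 this
  have heven : ∀ m, Even m → (σ : ZMod q) ^ m = (g : ZMod q) ^ m := by
    intro m hm
    rcases hσk with rfl | rfl
    · rw [hk]
    · push_cast
      rw [hm.neg_pow, hk]
  have hdvd : ∀ m, (g : ZMod q) ^ m = 1 → q - 1 ∣ m := by
    intro m hm
    rw [← hg', orderOf_dvd_iff_pow_eq_one]
    exact Units.ext (by simpa using hm)
  have h3 : q - 1 ∣ 2 * n := by
    apply hdvd
    rw [← heven _ (even_two_mul n), mul_comm, pow_mul, h2, one_pow]
  refine ⟨h3, fun h4 => hdvd _ ?_⟩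
  rw [← heven, h2]
  have := h4.trans h3
  rw [Nat.even_iff]
  omega

theorem conj_zpow_of_conj_eq {X : Type*} [Group X] {x y : X} {e : ℤ} (h : y * x * y⁻¹ = x ^ e)
    (j : ℤ) : y * x ^ j = x ^ (e * j) * y := by
  rw [← mul_inv_eq_iff_eq_mul, ← conj_zpow, h, zpow_mul]

theorem conj_pow_of_conj_eq {X : Type*} [Group X] {x y : X} {e : ℤ} (h : y * x * y⁻¹ = x ^ e)
    (n : ℕ) : y ^ n * x * (y ^ n)⁻¹ = x ^ e ^ n :=
  MulAut.pow_apply_eq_zpow MulAut.conj (h := y) (v := x) h n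

theorem mul_zpow_pow_of_conj_eq {X : Type*} [Group X] {x y : X} {e : ℤ}
    (h : y * x * y⁻¹ = x ^ e) (j : ℤ) (n : ℕ) :
    (y * x ^ j) ^ n = x ^ (j * ∑ i ∈ Finset.range n, e ^ (i + 1)) * y ^ n := by
  induction n with
  | zero => simp
  | succ n ih =>
    rw [pow_succ', ih, mul_assoc, ← mul_assoc (x ^ j), ← zpow_add, ← mul_assoc y,
      conj_zpow_of_conj_eq h, mul_assoc, ← pow_succ', Finset.sum_range_succ']
    congr 2
    simp only [pow_succ' e (_ + 1), ← Finset.mul_sum]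
    ring

namespace MonoidHom.ActsFreely
variable {X E : Type*} [Group X] [Ring E] [Nontrivial E] {ρ : X →* E}

theorem mem_zpowers_of_commute_prime_pow (hρ : ρ.ActsFreely)
    (hc : ∀ e : E, (Nat.card X : E) * e = 0 → e = 0) {p : ℕ} (hp : p.Prime) {b : X} {j : ℕ}
    (hb : orderOf b = p ^ j) (i : ℕ) (hij : i ≤ j) {a : X} (ha : a ^ p ^ i = 1)
    (hab : Commute a b) : a ∈ Subgroup.zpowers b := by
  induction i generalizing a with
  | zero => rw [pow_zero, pow_one] at ha; rw [ha]; exact one_mem _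
  | succ i ih =>
    obtain ⟨m, hm⟩ := ih (by omega) (a := a ^ p) (by rw [← pow_mul, ← pow_succ', ha])
      (hab.pow_left p)
    simp only at hm
    by_cases hpm : (p : ℤ) ∣ m
    · obtain ⟨k, rfl⟩ := hpm
      obtain ⟨j, rfl⟩ : ∃ j', j = j' + 1 := ⟨j - 1, by omega⟩
      have h1 : orderOf (b ^ p ^ j) = p := by
        rw [orderOf_pow_of_dvd (pow_pos hp.pos _).ne' (by rw [hb, pow_succ]; exact dvd_mul_right _ _),
          hb, pow_succ, Nat.mul_div_cancel_left _ (pow_pos hp.pos _)]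
      have h2 : a * b ^ (-k) ∈ Subgroup.zpowers (b ^ p ^ j) := by
        refine hρ.mem_zpowers_of_commute hc hp h1 ?_ ?_
        · rw [(hab.zpow_right _).mul_pow, ← hm, ← zpow_natCast, ← zpow_mul, ← zpow_add]
          simp [mul_comm]
        · exact ((hab.symm.pow_left _).mul_right ((Commute.refl b).pow_left _ |>.zpow_right _))
      have h3 : a * b ^ (-k) ∈ Subgroup.zpowers b :=
        (Subgroup.zpowers_le.2 (Subgroup.pow_mem _ (Subgroup.mem_zpowers b) _)) h2
      have h4 := Subgroup.mul_mem _ h3 (Subgroup.zpow_mem _ (Subgroup.mem_zpowers b) k)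
      rwa [mul_assoc, ← zpow_add, neg_add_cancel, zpow_zero, mul_one] at h4
    · exfalso
      have h1 : b ^ (m * (p : ℤ) ^ i) = 1 := by
        rw [zpow_mul, hm]
        rw [← ha, pow_succ', pow_mul]
        exact_mod_cast rfl
      rw [← orderOf_dvd_iff_zpow_eq_one, hb] at h1
      have h2 : IsCoprime ((p ^ j : ℕ) : ℤ) m := by
        push_cast
        exact ((Nat.prime_iff_prime_int.1 hp).coprime_iff_not_dvd.2 hpm).pow_left
      have h3 := h2.dvd_of_dvd_mul_left h1
      have h4 : p ^ j ∣ p ^ i := by exact_mod_cast h3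
      have := (Nat.pow_dvd_pow_iff_le_right hp.one_lt).1 h4
      omega

/-- In a group with a free action, a `p`-element normalizing but not centralizing `⟨x⟩`, where
`x` is a `p`-element, has a power in `⟨x⟩` as soon as that power centralizes `x`. -/
theorem pow_mem_zpowers (hρ : ρ.ActsFreely)
    (hc : ∀ e : E, (Nat.card X : E) * e = 0 → e = 0) {p : ℕ} (hp : p.Prime) {x y : X} {i j n : ℕ}
    (hx : orderOf x = p ^ j) (hy : y ^ p ^ i = 1) (hxy : ¬ Commute x y)
    (hcomm : Commute (y ^ n) x) : y ^ n ∈ Subgroup.zpowers x := by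
  obtain ⟨l, hl, hl'⟩ := (Nat.dvd_prime_pow hp).1 (orderOf_dvd_of_pow_eq_one
    (show (y ^ n) ^ p ^ i = 1 by rw [← pow_mul, mul_comm, pow_mul, hy, one_pow]))
  rcases le_total l j with h | h
  · exact hρ.mem_zpowers_of_commute_prime_pow hc hp hx l h (hl' ▸ pow_orderOf_eq_one _) hcomm
  · obtain ⟨m, hm⟩ := hρ.mem_zpowers_of_commute_prime_pow hc hp hl' j h
      (hx ▸ pow_orderOf_eq_one x) hcomm.symm
    refine absurd ?_ hxy
    simp only at hm
    rw [← hm]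
    exact ((Commute.refl y).pow_left n).zpow_left m

variable [Finite X]

theorem orderOf_ne_nine (hρ : ρ.ActsFreely)
    (hc : ∀ e : E, (Nat.card X : E) * e = 0 → e = 0) (hcut : IsCutGroup X) (x : X) :
    orderOf x ≠ 9 := by
  intro hx
  obtain ⟨d, hd⟩ := hcut.exists_conj_eq_zpow x 2 (by rw [hx]; rfl)
  have hd2 : d ^ 2 * x * (d ^ 2)⁻¹ = x ^ (4 : ℤ) := by
    rcases hd with hd | hd <;> exact conj_pow_of_conj_eq hd 2
  obtain ⟨s, m, hm, hdm⟩ := Nat.exists_eq_pow_mul_and_not_dvd (orderOf_pos d).ne' 3 (by norm_num)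
  have hm1 : m ^ 2 % 3 = 1 := by
    have : m % 3 = 1 ∨ m % 3 = 2 := by omega
    rcases this with h | h <;> simp [Nat.pow_mod, h]
  obtain ⟨t, ht⟩ : ∃ t, m ^ 2 = 3 * t + 1 := ⟨m ^ 2 / 3, by omega⟩
  set y := (d ^ 2) ^ m ^ 2 with hy
  have hxz : ∀ u v : ℤ, x ^ u = x ^ v ↔ (9 : ℤ) ∣ u - v := by
    intro u v
    rw [zpow_eq_zpow_iff_modEq, hx, Int.modEq_comm, Int.modEq_iff_dvd]; rfl
  have hyx : y * x * y⁻¹ = x ^ (4 : ℤ) := by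
    rw [hy, conj_pow_of_conj_eq hd2, hxz, ht, pow_succ, pow_mul]
    have h1 : (9 : ℤ) ∣ (4 ^ 3) ^ t - 1 ^ t := (by norm_num : (9 : ℤ) ∣ 4 ^ 3 - 1).trans
      (sub_dvd_pow_sub_pow _ _ t)
    rw [one_pow] at h1
    omega
  have hyp : y ^ 3 ^ s = 1 := by
    have h1 : d ^ (3 ^ s * m) = 1 := by rw [← hdm, pow_orderOf_eq_one]
    rw [hy, ← pow_mul, ← pow_mul]
    rw [show 2 * (m ^ 2 * 3 ^ s) = 3 ^ s * m * (2 * m) by ring, pow_mul, h1, one_pow]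
  have hncomm : ¬ Commute x y := by
    intro h
    have h1 : y * x * y⁻¹ = x ^ (1 : ℤ) := by rw [zpow_one, ← h.eq, mul_inv_cancel_right]
    rw [hyx, hxz] at h1
    norm_num at h1
  have hy3 : Commute (y ^ 3) x := by
    have h1 : y ^ 3 * x * (y ^ 3)⁻¹ = x ^ (1 : ℤ) := by
      rw [conj_pow_of_conj_eq hyx, hxz]; norm_num
    rw [zpow_one, mul_inv_eq_iff_eq_mul] at h1
    exact h1
  obtain ⟨l, hl⟩ := hρ.pow_mem_zpowers hc Nat.prime_three (j := 2) hx hyp hncomm hy3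
  simp only at hl
  have hl3 : (3 : ℤ) ∣ l := by
    have h1 := conj_zpow_of_conj_eq hyx l
    have h2 : y * x ^ l = x ^ l * y := by rw [hl]; exact ((Commute.refl y).pow_right 3)
    rw [h2, mul_left_inj, hxz] at h1
    omega
  obtain ⟨k, rfl⟩ := hl3
  have hz : (y * x ^ (-k)) ^ 3 = 1 := by
    rw [mul_zpow_pow_of_conj_eq hyx, ← hl, ← zpow_add, ← zpow_zero x, hxz]
    simp only [Finset.sum_range_succ, Finset.sum_range_zero]
    omega
  have hx3 : orderOf (x ^ 3) = 3 := by
    rw [orderOf_pow_of_dvd (by norm_num) (by rw [hx]; norm_num), hx]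
  have hcz : Commute (x ^ 3) (y * x ^ (-k)) := by
    refine Commute.mul_right ?_ ((Commute.refl x).pow_left 3 |>.zpow_right _)
    have h1 := conj_zpow_of_conj_eq hyx 3
    have h2 : x ^ (4 * 3 : ℤ) = x ^ (3 : ℤ) := by rw [hxz]; norm_num
    rw [h2] at h1
    exact_mod_cast h1.symm
  have hzm : y * x ^ (-k) ∈ Subgroup.zpowers x :=
    (Subgroup.zpowers_le.2 (Subgroup.pow_mem _ (Subgroup.mem_zpowers x) 3))
      (hρ.mem_zpowers_of_commute hc Nat.prime_three hx3 hz hcz)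
  have hym : y ∈ Subgroup.zpowers x := by
    have h1 := Subgroup.mul_mem _ hzm (Subgroup.zpow_mem _ (Subgroup.mem_zpowers x) k)
    rwa [mul_assoc, ← zpow_add, neg_add_cancel, zpow_zero, mul_one] at h1
  obtain ⟨u, hu⟩ := hym
  simp only at hu
  exact hncomm (hu ▸ (Commute.refl x).zpow_right u)

theorem orderOf_ne_eight (hρ : ρ.ActsFreely)
    (hc : ∀ e : E, (Nat.card X : E) * e = 0 → e = 0) (hcut : IsCutGroup X) (x : X) :
    orderOf x ≠ 8 := by
  intro hx
  have hxz : ∀ u v : ℤ, x ^ u = x ^ v ↔ (8 : ℤ) ∣ u - v := by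
    intro u v
    rw [zpow_eq_zpow_iff_modEq, hx, Int.modEq_comm, Int.modEq_iff_dvd]; rfl
  obtain ⟨d, e, hd, he⟩ : ∃ d, ∃ e : ℤ, d * x * d⁻¹ = x ^ e ∧ (e = 3 ∨ e = 5) := by
    obtain ⟨d, hd⟩ := hcut.exists_conj_eq_zpow x 3 (by rw [hx]; rfl)
    rcases hd with hd | hd
    · exact ⟨d, 3, hd, Or.inl rfl⟩
    · refine ⟨d, 5, ?_, Or.inr rfl⟩
      rw [hd, hxz]
      norm_num
  have he2 : (8 : ℤ) ∣ e ^ 2 - 1 := by rcases he with rfl | rfl <;> norm_num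
  obtain ⟨s, m, hm, hdm⟩ := Nat.exists_eq_pow_mul_and_not_dvd (orderOf_pos d).ne' 2 (by norm_num)
  obtain ⟨t, ht⟩ : ∃ t, m = 2 * t + 1 := ⟨m / 2, by omega⟩
  set y := d ^ m with hy
  have hyx : y * x * y⁻¹ = x ^ e := by
    rw [hy, conj_pow_of_conj_eq hd, hxz, ht, pow_succ, pow_mul]
    have h1 : (8 : ℤ) ∣ (e ^ 2) ^ t - 1 := by simpa using he2.trans (sub_dvd_pow_sub_pow (e ^ 2) 1 t)
    have h2 := h1.mul_right e
    rwa [sub_mul, one_mul] at h2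
  have hyp : y ^ 2 ^ s = 1 := by
    rw [hy, ← pow_mul, mul_comm, ← hdm, pow_orderOf_eq_one]
  have hncomm : ¬ Commute x y := by
    intro h
    have h1 : y * x * y⁻¹ = x ^ (1 : ℤ) := by rw [zpow_one, ← h.eq, mul_inv_cancel_right]
    rw [hyx, hxz] at h1
    rcases he with rfl | rfl <;> norm_num at h1
  have hy2 : Commute (y ^ 2) x := by
    have h1 : y ^ 2 * x * (y ^ 2)⁻¹ = x ^ (1 : ℤ) := by
      rw [conj_pow_of_conj_eq hyx, hxz]; exact he2
    rw [zpow_one, mul_inv_eq_iff_eq_mul] at h1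
    exact h1
  obtain ⟨l, hl⟩ := hρ.pow_mem_zpowers hc Nat.prime_two (j := 3) hx hyp hncomm hy2
  simp only at hl
  have hel : (8 : ℤ) ∣ e * l - l := by
    have h1 := conj_zpow_of_conj_eq hyx l
    have h2 : y * x ^ l = x ^ l * y := by rw [hl]; exact ((Commute.refl y).pow_right 2)
    rwa [h2, mul_left_inj, eq_comm, hxz] at h1
  obtain ⟨k, hk⟩ : ∃ k : ℤ, (8 : ℤ) ∣ k * (e + e ^ 2) + l := by
    rcases he with rfl | rfl
    · rcases (by omega : (8 : ℤ) ∣ l ∨ (8 : ℤ) ∣ 4 + l) with h | h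
      · exact ⟨0, by omega⟩
      · exact ⟨1, by omega⟩
    · obtain ⟨k, rfl⟩ : (2 : ℤ) ∣ l := by omega
      exact ⟨k, by omega⟩
  have hz : (y * x ^ k) ^ 2 = 1 := by
    rw [mul_zpow_pow_of_conj_eq hyx, ← hl, ← zpow_add, ← zpow_zero x, hxz]
    simp only [Finset.sum_range_succ, Finset.sum_range_zero]
    convert hk using 1
    ring
  have hx4 : orderOf (x ^ 4) = 2 := by
    rw [orderOf_pow_of_dvd (by norm_num) (by rw [hx]; norm_num), hx]
  have hzm : y * x ^ k ∈ Subgroup.zpowers x := by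
    by_cases h1 : y * x ^ k = 1
    · rw [h1]; exact one_mem _
    · rw [hρ.eq_of_sq_eq_one h1 hz (fun h => by simp [h] at hx4) (hx4 ▸ pow_orderOf_eq_one _)]
      exact Subgroup.pow_mem _ (Subgroup.mem_zpowers x) 4
  have hym : y ∈ Subgroup.zpowers x := by
    have h1 := Subgroup.mul_mem _ hzm (Subgroup.zpow_mem _ (Subgroup.mem_zpowers x) (-k))
    rwa [mul_assoc, ← zpow_add, add_neg_cancel, zpow_zero, mul_one] at h1
  obtain ⟨u, hu⟩ := hym
  simp only at hu
  exact hncomm (hu ▸ (Commute.refl x).zpow_right u)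

theorem le_three_of_prime_dvd_card (hρ : ρ.ActsFreely)
    (hc : ∀ e : E, (Nat.card X : E) * e = 0 → e = 0) (hcut : IsCutGroup X) {p : ℕ} (hp : p.Prime)
    (hpX : p ∣ Nat.card X) : p ≤ 3 := by
  induction p using Nat.strong_induction_on with
  | _ p ih =>
  by_contra! hp3
  have := Fact.mk hp
  obtain ⟨a, ha⟩ := exists_prime_orderOf_dvd_card' p hpX
  obtain ⟨d, σ, hd, hn⟩ := exists_apply_eq_zpow_of_cut MulAut.conj hp ha fun k hk =>
    hcut.exists_conj_eq_zpow a k (by rw [ha]; exact hk)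
  have hd' : d * a * d⁻¹ = a ^ σ := hd
  have hcomm : ∀ n, Commute (d ^ n) a → p - 1 ∣ 2 * n ∧ (4 ∣ p - 1 → p - 1 ∣ n) := fun n h =>
    hn n (mul_inv_eq_iff_eq_mul.2 h)
  obtain ⟨h1, h2⟩ := hcomm (orderOf d) (by rw [pow_orderOf_eq_one]; exact Commute.one_left a)
  have hodd := hp.eq_two_or_odd'.resolve_left (by omega)
  have hpos := orderOf_pos d
  obtain ⟨m, hm⟩ : ∃ m, p - 1 = 2 * m := by
    obtain ⟨m, hm⟩ := hodd
    exact ⟨m, by omega⟩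
  have hpow : ∀ k, k ∣ orderOf d → orderOf (d ^ (orderOf d / k)) = k := fun k hk =>
    orderOf_pow_orderOf_div hpos.ne' hk
  have h8 : ¬ 8 ∣ orderOf d := fun h => hρ.orderOf_ne_eight hc hcut _ (hpow 8 h)
  have h9 : ¬ 9 ∣ orderOf d := fun h => hρ.orderOf_ne_nine hc hcut _ (hpow 9 h)
  by_cases h4 : 4 ∣ p - 1
  · have h4d := h4.trans (h2 h4)
    have ho := hpow 2 (by omega)
    have hcen := hρ.commute_of_sq_eq_one (t := d ^ (orderOf d / 2))
      (fun h => by simp [h] at ho)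
      (by have h := pow_orderOf_eq_one (d ^ (orderOf d / 2)); rwa [ho] at h) a
    have h5 := h4.trans ((hcomm _ hcen).2 h4)
    omega
  by_cases h3 : 3 ∣ p - 1
  · have h3d := h3.trans h1
    have ho := hpow 3 (by omega)
    have hcen := hρ.commute_of_normalizes hc hp Nat.prime_three ha ho (by
      rw [conj_pow_of_conj_eq hd']; exact Subgroup.zpow_mem _ (Subgroup.mem_zpowers a) _)
    have h5 := h3.trans (hcomm _ hcen.symm).1
    omega
  have hr := Nat.minFac_prime (n := m) (by omega)
  have hrm := Nat.minFac_dvd m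
  have hmd : m ∣ orderOf d := by
    rw [hm] at h1
    exact Nat.dvd_of_mul_dvd_mul_left (by norm_num) h1
  have hle := ih _ (lt_of_le_of_lt (Nat.le_of_dvd (by omega) hrm) (by omega)) hr
    ((hrm.trans hmd).trans (orderOf_dvd_natCard d))
  have h22 := hr.two_le
  interval_cases m.minFac <;> omega

theorem orderOf_dvd_twelve (hρ : ρ.ActsFreely)
    (hc : ∀ e : E, (Nat.card X : E) * e = 0 → e = 0) (hcut : IsCutGroup X) (x : X) :
    orderOf x ∣ 12 := by
  have hpow : ∀ k, k ∣ orderOf x → orderOf (x ^ (orderOf x / k)) = k := fun k hk =>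
    orderOf_pow_orderOf_div (orderOf_pos x).ne' hk
  have h8 : ¬ 8 ∣ orderOf x := fun h => hρ.orderOf_ne_eight hc hcut _ (hpow 8 h)
  have h9 : ¬ 9 ∣ orderOf x := fun h => hρ.orderOf_ne_nine hc hcut _ (hpow 9 h)
  rw [Nat.dvd_iff_prime_pow_dvd_dvd]
  intro p k hp hk
  rcases Nat.eq_zero_or_pos k with rfl | hk0
  · simp
  have h1 : p ∣ orderOf x := (dvd_pow_self p hk0.ne').trans hk
  have h2 := hρ.le_three_of_prime_dvd_card hc hcut hp (h1.trans (orderOf_dvd_natCard x))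
  have h3 := hp.two_le
  interval_cases p
  · have : k < 3 := by
      by_contra! h
      exact h8 ((pow_dvd_pow 2 h).trans hk)
    interval_cases k <;> norm_num
  · have : k < 2 := by
      by_contra! h
      exact h9 ((pow_dvd_pow 3 h).trans hk)
    interval_cases k; norm_num

end MonoidHom.ActsFreely

/-- The action of the automorphisms of a commutative group on the additive copy of that group. -/
def MulAut.toEndAdditive (V : Type*) [CommGroup V] : MulAut V →* AddMonoid.End (Additive V) :=
  (monoidEndToAdditive V).toMonoidHom.comp (MulDistribMulAction.toMonoidEnd (MulAut V) V)

section
variable {V : Type*} [CommGroup V]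

theorem MulAut.toEndAdditive_injective : Function.Injective (MulAut.toEndAdditive V) := by
  intro σ τ h
  ext v
  have := DFunLike.congr_fun h (Additive.ofMul v)
  exact this

theorem MonoidHom.actsFreely_toEndAdditive {X : Type*} [Group X] (φ : X →* MulAut V)
    (hφ : ∀ h ≠ 1, ∀ v, φ h v = v → v = 1) : ((MulAut.toEndAdditive V).comp φ).ActsFreely := by
  intro h hh e he
  ext v
  exact hφ h hh _ (DFunLike.congr_fun he v)

theorem IsPGroup.eq_zero_of_natCast_mul_eq_zero {q : ℕ} (hq : q.Prime) (hV : IsPGroup q V) {m : ℕ}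
    (hm : ¬ q ∣ m) (e : AddMonoid.End (Additive V)) (he : (m : AddMonoid.End (Additive V)) * e = 0) :
    e = 0 := by
  ext v
  have h1 : m • e v = 0 := DFunLike.congr_fun he v
  obtain ⟨k, hk⟩ := hV (e v).toMul
  have h2 : ((e v).toMul) ^ m = 1 := h1
  have h3 : Nat.Coprime (q ^ k) m := ((hq.coprime_iff_not_dvd).2 hm).pow_left k
  have h4 := Nat.dvd_gcd (orderOf_dvd_of_pow_eq_one hk) (orderOf_dvd_of_pow_eq_one h2)
  rw [h3.gcd_eq_one, Nat.dvd_one, orderOf_eq_one_iff] at h4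
  exact h4

theorem IsPGroup.orderOf_ne_of_actsFreely {X : Type*} [Group X] [Finite V] [Nontrivial V] {q : ℕ}
    (hq : q.Prime) (hV : IsPGroup q V) (φ : X →* MulAut V) {h : X}
    (hφ : ∀ v, φ h v = v → v = 1) : orderOf h ≠ q := by
  intro ho
  have := Fact.mk hq
  have hP : IsPGroup q (Subgroup.zpowers h) :=
    IsPGroup.of_card (n := 1) (by rw [Nat.card_zpowers, ho, pow_one])
  let _ : MulAction (Subgroup.zpowers h) V :=
    MulAction.compHom V (φ.comp (Subgroup.zpowers h).subtype)
  obtain ⟨n, hn0, hn⟩ := hV.nontrivial_iff_card.1 inferInstance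
  obtain ⟨b, hb, hb1⟩ := hP.exists_fixed_point_of_prime_dvd_card_of_fixed_point V
    (hn.symm ▸ dvd_pow_self _ hn0.ne') (a := 1) (fun x => map_one (φ x))
  exact hb1 (hφ b (hb ⟨h, Subgroup.mem_zpowers h⟩)).symm

theorem IsPGroup.map_eq_one_of_actsFreely {X : Type*} [Group X] [Finite X] {q : ℕ} (hq : q.Prime)
    (hV : IsPGroup q V) (α : X →* MulAut V) (M : Subgroup X) [M.Normal]
    (hM : ¬ q ∣ Nat.card (M.map α)) {g : X} (hg : ∀ v, α g v = v → v = 1)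
    (hgM : ∀ i, g ^ i ≠ 1 → ∀ m ∈ M, Commute m (g ^ i) → m = 1) {m : X} (hm : m ∈ M) :
    α m = 1 := by
  have := Finite.of_surjective _ (α.subgroupMap_surjective M)
  apply MulAut.toEndAdditive_injective
  rw [map_one]
  refine MonoidHom.map_eq_one_of_geom_sum_eq_zero (MulAut.toEndAdditive V) (M.map α) (β := α g)
    (orderOf_pos g) ?_ ?_ ?_ (hV.eq_zero_of_natCast_mul_eq_zero hq hM)
    (Subgroup.mem_map_of_mem α hm)
  · have h1 := mul_geom_sum (MulAut.toEndAdditive V (α g)) (orderOf g)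
    rw [← map_pow, ← map_pow, pow_orderOf_eq_one, map_one, map_one, sub_self, sub_mul, one_mul,
      sub_eq_zero] at h1
    ext v
    exact hg _ (DFunLike.congr_fun h1 v)
  · rintro _ ⟨s, hs, rfl⟩
    exact ⟨g * s * g⁻¹, Subgroup.Normal.conj_mem inferInstance s hs g, by simp⟩
  · rintro i h0 hi _ ⟨r, hr, rfl⟩
    have hgi : g ^ i ≠ 1 := fun h => (Nat.le_of_dvd h0 (orderOf_dvd_of_pow_eq_one h)).not_gt hi
    let f : M → M := fun s => ⟨s * (g ^ i * (s : X)⁻¹ * (g ^ i)⁻¹),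
      M.mul_mem s.2 (Subgroup.Normal.conj_mem inferInstance _ (M.inv_mem s.2) _)⟩
    have hf : Function.Injective f := by
      intro s t hst
      have h1 : (s : X) * (g ^ i * (s : X)⁻¹ * (g ^ i)⁻¹) = t * (g ^ i * (t : X)⁻¹ * (g ^ i)⁻¹) :=
        congrArg Subtype.val hst
      have h2 : ((t : X)⁻¹ * s) = 1 := by
        refine hgM i hgi _ (M.mul_mem (M.inv_mem t.2) s.2) ?_
        have h3 : (s : X) * g ^ i * (s : X)⁻¹ = t * g ^ i * (t : X)⁻¹ := by
          simpa [← mul_assoc] using h1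
        show (t : X)⁻¹ * s * g ^ i = g ^ i * ((t : X)⁻¹ * s)
        calc (t : X)⁻¹ * s * g ^ i = (t : X)⁻¹ * ((s : X) * g ^ i * (s : X)⁻¹) * s := by group
          _ = _ := by rw [h3]; group
      exact Subtype.ext (inv_mul_eq_one.1 h2).symm
    obtain ⟨s, hs⟩ := (Finite.injective_iff_surjective.1 hf) ⟨r, hr⟩
    have hs' : (s : X) * (g ^ i * (s : X)⁻¹ * (g ^ i)⁻¹) = r := congrArg Subtype.val hs
    refine ⟨α s, ⟨s, s.2, rfl⟩, ?_⟩
    rw [← hs']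
    simp [mul_assoc]
end

open Subgroup in
/-- A nontrivial `q`-subgroup `Q` has a nontrivial abelian subgroup that is central in `Q` and
normalized by the normalizer of `Q`. -/
theorem IsPGroup.exists_le_centralizer {G : Type*} [Group G] [Finite G] {q : ℕ} [Fact q.Prime]
    {Q : Subgroup G} (hQp : IsPGroup q Q) [Nontrivial Q] :
    ∃ V : Subgroup G, V ≤ Q ∧ V ≤ centralizer (Q : Set G) ∧ IsMulCommutative V ∧ Nontrivial V ∧
      normalizer (Q : Set G) ≤ normalizer (V : Set G) := by
  set V : Subgroup G := Q ⊓ centralizer (Q : Set G) with hV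
  have hVQ : V ≤ Q := inf_le_left
  have hVcomm : IsMulCommutative V :=
    ⟨⟨fun a b => Subtype.ext ((mem_centralizer_iff.1 b.2.2 _ a.2.1))⟩⟩
  have hVnt : Nontrivial V := by
    have := hQp.center_nontrivial
    obtain ⟨z, hz⟩ := exists_ne (1 : center Q)
    refine ⟨⟨⟨z, z.1.2, mem_centralizer_iff.2 fun y hy => ?_⟩, 1, fun h => hz ?_⟩⟩
    · exact congrArg Subtype.val (mem_center_iff.1 z.2 ⟨y, hy⟩)
    · exact Subtype.ext (Subtype.ext (congrArg (fun t : V => (t : G)) h))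
  refine ⟨V, hVQ, inf_le_right, hVcomm, hVnt, ?_⟩
  have key : ∀ x ∈ normalizer (Q : Set G), ∀ v ∈ V, x * v * x⁻¹ ∈ V := by
    intro x hx v hv
    refine ⟨(mem_normalizer_iff.1 hx v).1 hv.1, mem_centralizer_iff.2 fun y hy => ?_⟩
    have h1 := mem_centralizer_iff.1 hv.2 _ ((mem_normalizer_iff''.1 hx y).1 hy)
    calc y * (x * v * x⁻¹) = x * (x⁻¹ * y * x * v) * x⁻¹ := by group
      _ = _ := by rw [h1]; group
  intro x hx
  refine mem_normalizer_iff.2 fun v => ⟨key x hx v, fun hv => ?_⟩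
  have := key _ (inv_mem hx) _ hv
  simpa [mul_assoc] using this

open scoped IsMulCommutative in
open Subgroup in
/-- A section of a group relative to a kernel-like normal subgroup `N` acts on the centre `V` of a
Sylow subgroup of `N`; the action controls the fusion of `V`, and is free on `K / N` when the
centralizers in `K` of the nonidentity elements of `N` lie in `N`. -/
theorem exists_mulAut_of_centralizer_le {G : Type u} [Group G] [Finite G] (N K : Subgroup G)
    [N.Normal] (hNK : N ≤ K) (hKN : ¬ K ≤ N)
    (hc : ∀ n ∈ N, n ≠ 1 → ∀ g ∈ K, g * n = n * g → g ∈ N) {q : ℕ} (hq : q.Prime)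
    (hqN : q ∣ Nat.card N) :
    ∃ (V : Type u) (_ : CommGroup V) (ι : V →* G) (φ : G ⧸ N →* MulAut V),
      Function.Injective ι ∧ Nontrivial V ∧ IsPGroup q V ∧
      (∀ h ∈ K.map (QuotientGroup.mk' N), h ≠ 1 → ∀ v, φ h v = v → v = 1) ∧
      ∀ (v w : V) (g : G), g * ι v * g⁻¹ = ι w → ∃ h, φ h v = w := by
  have := Fact.mk hq
  obtain ⟨P⟩ : Nonempty (Sylow q N) := inferInstance
  set Q : Subgroup G := (P : Subgroup N).map N.subtype with hQ
  have hQN : Q ≤ N := map_subtype_le _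
  have hQp : IsPGroup q Q := P.isPGroup'.map _
  have hfr : normalizer (Q : Set G) ⊔ N = ⊤ := Sylow.normalizer_sup_eq_top P
  have hQnt : Nontrivial Q := by
    have h1 : q ∣ Nat.card Q := by
      rw [hQ, card_map_of_injective N.subtype_injective]
      exact P.dvd_card_of_dvd_card hqN
    exact (one_lt_card_iff_ne_bot _).1 (hq.one_lt.trans_le (Nat.le_of_dvd Nat.card_pos h1)) |>
      (nontrivial_iff_ne_bot _).2
  obtain ⟨V, hVQ, hVc, hVcomm, hVnt, hnorm⟩ := hQp.exists_le_centralizer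
  have hVp : IsPGroup q V := hQp.to_le hVQ
  set X := normalizer (Q : Set G)
  let α : X →* MulAut V := V.normalizerMonoidHom.comp (inclusion hnorm)
  have hα : ∀ (x : X) (v : V), (α x v : G) = x * v * (x : G)⁻¹ := fun x v => rfl
  have hMc : ¬ q ∣ Nat.card ((N.subgroupOf X).map α) := by
    have h1 : Q.subgroupOf X ≤ α.ker := by
      intro x hx
      ext v
      rw [hα, MulAut.one_apply, mul_inv_eq_iff_eq_mul]
      exact mem_centralizer_iff.1 (hVc v.2) _ hx
    have h2 : Nat.card ((N.subgroupOf X).map α) ∣ P.index := by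
      rw [← relIndex_ker]
      refine (relIndex_dvd_of_le_left _ h1).trans ?_
      have h3 : (Q.subgroupOf X).relIndex (N.subgroupOf X) = Q.relIndex (N ⊓ X) := by
        rw [← inf_subgroupOf_right N X, relIndex_subgroupOf inf_le_right]
      have h4 : P.index = Q.relIndex N := by
        rw [relIndex, hQ, ← comap_subtype, comap_map_eq_self_of_injective N.subtype_injective]
      rw [h3, h4, ← relIndex_mul_relIndex Q (N ⊓ X) N (le_inf hQN le_normalizer) inf_le_left]
      exact dvd_mul_right _ _
    exact fun h => P.not_dvd_index (h.trans h2)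
  obtain ⟨g₀, hg₀K, hg₀N⟩ := SetLike.not_le_iff_exists.1 hKN
  obtain ⟨x, hx, n, hn, rfl⟩ := mem_sup_of_normal_right.1 (hfr.symm ▸ mem_top g₀)
  have hxK : x ∈ K := (mul_mem_cancel_right (hNK hn)).1 hg₀K
  have hxN : x ∉ N := fun h => hg₀N (mul_mem h hn)
  have hfree : ∀ y : X, (y : G) ∈ K → (y : G) ∉ N → ∀ v, α y v = v → v = 1 := by
    intro y hyK hyN v hv
    by_contra hv1
    refine hyN (hc v (hQN (hVQ v.2)) (fun h => hv1 (Subtype.ext h)) y hyK ?_)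
    have := congrArg Subtype.val hv
    rw [hα] at this
    exact mul_inv_eq_iff_eq_mul.1 this
  have htriv : ∀ m ∈ N.subgroupOf X, α m = 1 := fun m hm => by
    refine hVp.map_eq_one_of_actsFreely hq α (N.subgroupOf X) hMc (g := ⟨x, hx⟩) (hfree _ hxK hxN) (by
      intro i hi m hm hcomm
      have hi' : x ^ i ≠ 1 := fun h => hi (Subtype.ext h)
      have hcomm' : x ^ i * m = m * x ^ i := congrArg Subtype.val hcomm.symm.eq
      by_contra hm1
      have h1 : x ^ i ∈ N := hc m hm (fun h => hm1 (Subtype.ext h)) _ (pow_mem hxK i) hcomm'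
      exact hxN (hc _ h1 hi' x hxK ((Commute.refl x).pow_right i))) hm
  let π : X →* G ⧸ N := (QuotientGroup.mk' N).comp X.subtype
  have hπ : Function.Surjective π := by
    intro y
    obtain ⟨g, rfl⟩ := QuotientGroup.mk'_surjective N y
    obtain ⟨x, hx, n, hn, rfl⟩ := mem_sup_of_normal_right.1 (hfr.symm ▸ mem_top g)
    refine ⟨⟨x, hx⟩, ?_⟩
    simpa [π] using hn
  have hker : π.ker ≤ α.ker := fun m hm => htriv m ((QuotientGroup.eq_one_iff (m : G)).1 hm)
  let φ : G ⧸ N →* MulAut V := π.liftOfSurjective hπ ⟨α, hker⟩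
  have hφ : ∀ x, φ (π x) = α x := fun x => MonoidHom.liftOfRightInverse_comp_apply _ _ _ _ _
  refine ⟨V, inferInstance, V.subtype, φ, V.subtype_injective, hVnt, hVp, ?_, ?_⟩
  · rintro h ⟨k, hk, rfl⟩ hk1
    obtain ⟨y, hy⟩ := hπ (QuotientGroup.mk' N k)
    rw [← hy, hφ]
    have h1 : (y : G)⁻¹ * k ∈ N := QuotientGroup.eq.1 hy
    refine hfree y ?_ fun h => hk1 ?_
    · have := mul_mem hk (inv_mem (hNK h1))
      simpa using this
    · exact (QuotientGroup.eq_one_iff _).2 ((mul_mem_cancel_left (inv_mem h)).1 h1)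
  · intro v w g hg
    simp only [subtype_apply] at hg
    obtain ⟨x, hx, n, hn, rfl⟩ := mem_sup_of_normal_right.1 (hfr.symm ▸ mem_top g)
    have hcz : ∀ u : V, (⟨u, hQN (hVQ u.2)⟩ : N) ∈ centralizer (P : Set N) := by
      refine fun u => mem_centralizer_iff.2 fun y hy => Subtype.ext ?_
      exact mem_centralizer_iff.1 (hVc u.2) _ ⟨y, hy, rfl⟩
    set u : V := (α ⟨x, hx⟩)⁻¹ w
    have hu : n * v * n⁻¹ = u := by
      have h1 : (α ⟨x, hx⟩ u : G) = x * u * x⁻¹ := hα _ _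
      rw [MulAut.apply_inv_self, ← hg] at h1
      have h2 : x * (n * v * n⁻¹) * x⁻¹ = x * u * x⁻¹ := by rw [← h1]; group
      simpa using h2
    obtain ⟨m, hm, hm'⟩ := P.conj_eq_normalizer_conj_of_mem_centralizer
      ⟨v, hQN (hVQ v.2)⟩ (⟨n, hn⟩⁻¹) (hcz v) (by
        convert hcz u using 1
        exact Subtype.ext (by simpa using hu))
    have hmX : ((m⁻¹ : N) : G) ∈ X := by
      have := le_normalizer_map N.subtype (mem_map_of_mem N.subtype (inv_mem hm))
      exact this
    have hm2 : (u : G) = (m : G)⁻¹ * v * m := by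
      have := congrArg Subtype.val hm'
      rw [← hu]
      simpa using this
    refine ⟨π (⟨x, hx⟩ * ⟨_, hmX⟩), ?_⟩
    rw [hφ, map_mul, MulAut.mul_apply]
    have h3 : α ⟨_, hmX⟩ v = u := Subtype.ext (by rw [hα, hm2]; simp)
    rw [h3, MulAut.apply_inv_self]

theorem Nat.card_primeFactors_le_three_of_forall {n r : ℕ}
    (h : ∀ p, p.Prime → p ∣ n → p = 2 ∨ p = 3 ∨ p = r) : n.primeFactors.card ≤ 3 := by
  refine (Finset.card_le_card (t := {2, 3, r}) fun p hp => ?_).trans Finset.card_le_three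
  have := h p (Nat.prime_of_mem_primeFactors hp) (Nat.dvd_of_mem_primeFactors hp)
  simpa using this

theorem eq_two_or_three_of_prime_dvd_twelve {p : ℕ} (hp : p.Prime) (h : p ∣ 12) :
    p = 2 ∨ p = 3 := by
  have h2 := Nat.le_of_dvd (by norm_num) h
  interval_cases p <;> revert hp h <;> norm_num

section
variable {G : Type u} [Group G] [Finite G] (N K : Subgroup G) [N.Normal]

theorem IsCutGroup.exists_mulAut (hcut : IsCutGroup G) (hNK : N ≤ K) (hKN : ¬ K ≤ N)
    (hc : ∀ n ∈ N, n ≠ 1 → ∀ g ∈ K, g * n = n * g → g ∈ N) {q : ℕ} (hq : q.Prime)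
    (hqN : q ∣ Nat.card N) :
    ∃ (V : Type u) (_ : CommGroup V) (φ : G ⧸ N →* MulAut V),
      Nontrivial V ∧ IsPGroup q V ∧ (∃ v : V, orderOf v = q) ∧
      (∀ h ∈ K.map (QuotientGroup.mk' N), h ≠ 1 → ∀ v, φ h v = v → v = 1) ∧
      ∀ v, orderOf v = q → ∃ h, ∃ σ : ℤ, φ h v = v ^ σ ∧
        ∀ n : ℕ, φ (h ^ n) v = v → q - 1 ∣ 2 * n ∧ (4 ∣ q - 1 → q - 1 ∣ n) := by
  obtain ⟨V, hV, ι, φ, hι, hVnt, hVp, hfree, hfus⟩ :=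
    exists_mulAut_of_centralizer_le N K hNK hKN hc hq hqN
  have : Finite V := Finite.of_injective ι hι
  have := Fact.mk hq
  refine ⟨V, hV, φ, hVnt, hVp, ?_, hfree, fun v hv => exists_apply_eq_zpow_of_cut φ hq hv ?_⟩
  · obtain ⟨n, hn0, hn⟩ := hVp.nontrivial_iff_card.1 hVnt
    exact exists_prime_orderOf_dvd_card' q (hn ▸ dvd_pow_self _ hn0.ne')
  · intro k hk
    obtain ⟨d, hd⟩ := hcut.exists_conj_eq_zpow (ι v) k (by rw [orderOf_injective ι hι, hv]; exact hk)
    rcases hd with hd | hd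
    · obtain ⟨h, hh⟩ := hfus v (v ^ k) d (by rw [map_zpow]; exact hd)
      exact ⟨h, Or.inl hh⟩
    · obtain ⟨h, hh⟩ := hfus v (v ^ (-k)) d (by rw [map_zpow]; exact hd)
      exact ⟨h, Or.inr hh⟩

theorem not_dvd_card_map_of_centralizer_le (hNK : N ≤ K)
    (hc : ∀ n ∈ N, n ≠ 1 → ∀ g ∈ K, g * n = n * g → g ∈ N) {q : ℕ} (hq : q.Prime)
    (hqN : q ∣ Nat.card N) : ¬ q ∣ Nat.card (K.map (QuotientGroup.mk' N)) := by
  intro hd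
  have := Fact.mk hq
  obtain ⟨h, ho⟩ := exists_prime_orderOf_dvd_card' q hd
  rw [← Subgroup.orderOf_coe] at ho
  have h1 : (h : G ⧸ N) ≠ 1 := fun h1 => by rw [h1, orderOf_one] at ho; exact hq.one_lt.ne ho
  have hKN : ¬ K ≤ N := by
    intro hle
    obtain ⟨_, k, hk, rfl⟩ := h
    exact h1 ((QuotientGroup.eq_one_iff k).2 (hle hk))
  obtain ⟨V, hV, ι, φ, hι, hVnt, hVp, hfree, -⟩ :=
    exists_mulAut_of_centralizer_le N K hNK hKN hc hq hqN
  have : Finite V := Finite.of_injective ι hι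
  exact hVp.orderOf_ne_of_actsFreely hq φ (hfree h h.2 h1) ho

theorem exists_actsFreely_of_centralizer_le (hN : N ≠ ⊥) (hNK : N ≤ K) (hKN : ¬ K ≤ N)
    (hc : ∀ n ∈ N, n ≠ 1 → ∀ g ∈ K, g * n = n * g → g ∈ N) :
    ∃ (E : Type u) (_ : Ring E) (_ : Nontrivial E) (ρ : K.map (QuotientGroup.mk' N) →* E),
      ρ.ActsFreely ∧ ∀ e : E, (Nat.card (K.map (QuotientGroup.mk' N)) : E) * e = 0 → e = 0 := by
  obtain ⟨q, hq, hqN⟩ := Nat.exists_prime_and_dvd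
    (fun h => hN (Subgroup.card_eq_one.1 h) : Nat.card N ≠ 1)
  obtain ⟨V, hV, ι, φ, hι, hVnt, hVp, hfree, -⟩ :=
    exists_mulAut_of_centralizer_le N K hNK hKN hc hq hqN
  refine ⟨AddMonoid.End (Additive V), inferInstance, ?_, (MulAut.toEndAdditive V).comp
    (φ.comp (Subgroup.subtype _)), MonoidHom.actsFreely_toEndAdditive _ ?_,
    hVp.eq_zero_of_natCast_mul_eq_zero hq (not_dvd_card_map_of_centralizer_le N K hNK hc hq hqN)⟩
  · obtain ⟨v, hv⟩ := exists_ne (1 : V)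
    exact ⟨1, 0, fun h => hv (DFunLike.congr_fun h (Additive.ofMul v))⟩
  · exact fun h hh v hv => hfree h h.2 (fun h1 => hh (Subtype.ext h1)) v hv

variable {N}

theorem not_dvd_card_quotient (hc : ∀ n ∈ N, n ≠ 1 → ∀ g, g * n = n * g → g ∈ N) {q : ℕ}
    (hq : q.Prime) (hqN : q ∣ Nat.card N) : ¬ q ∣ Nat.card (G ⧸ N) := by
  have := not_dvd_card_map_of_centralizer_le N ⊤ le_top (fun n hn hn1 g _ => hc n hn hn1 g) hq hqN
  rwa [← MonoidHom.range_eq_map, MonoidHom.range_eq_top.2 (QuotientGroup.mk'_surjective N),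
    Subgroup.card_top] at this

theorem IsCutGroup.orderOf_quotient_dvd_twelve (hcut : IsCutGroup G) (hN : N ≠ ⊥) (hN' : N ≠ ⊤)
    (hc : ∀ n ∈ N, n ≠ 1 → ∀ g, g * n = n * g → g ∈ N) (y : G ⧸ N) : orderOf y ∣ 12 := by
  obtain ⟨E, hE, hE', ρ, hρ, hρc⟩ := exists_actsFreely_of_centralizer_le N ⊤ hN le_top
    (fun h => hN' (top_le_iff.1 h)) (fun n hn hn1 g _ => hc n hn hn1 g)
  have htop : ∀ y, y ∈ (⊤ : Subgroup G).map (QuotientGroup.mk' N) := fun y => by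
    obtain ⟨g, rfl⟩ := QuotientGroup.mk'_surjective N y
    exact ⟨g, Subgroup.mem_top g, rfl⟩
  let f : G →* (⊤ : Subgroup G).map (QuotientGroup.mk' N) :=
    (QuotientGroup.mk' N).codRestrict _ fun g => htop _
  have hf : Function.Surjective f := by
    rintro ⟨_, g, -, rfl⟩
    exact ⟨g, rfl⟩
  have := hρ.orderOf_dvd_twelve hρc (hcut.of_surjective f hf) ⟨y, htop y⟩
  rwa [← Subgroup.orderOf_coe] at this

theorem eq_two_or_three_of_dvd_card_of_orderOf_dvd {X : Type*} [Group X] [Finite X]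
    (h : ∀ x : X, orderOf x ∣ 12) {p : ℕ} (hp : p.Prime) (hpX : p ∣ Nat.card X) :
    p = 2 ∨ p = 3 := by
  have := Fact.mk hp
  obtain ⟨x, hx⟩ := exists_prime_orderOf_dvd_card' p hpX
  exact eq_two_or_three_of_prime_dvd_twelve hp (hx ▸ h x)

theorem orderOf_dvd_three_of_odd_card {X : Type*} [Group X] [Finite X]
    (h : ∀ x : X, orderOf x ∣ 12) (hodd : Odd (Nat.card X)) (x : X) : orderOf x ∣ 3 := by
  have h1 : Odd (orderOf x) := hodd.of_dvd_nat (orderOf_dvd_natCard x)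
  have h2 : Nat.Coprime (orderOf x) 4 := (Nat.coprime_two_right.2 h1).pow_right 2
  exact h2.dvd_of_dvd_mul_left (h x : orderOf x ∣ 4 * 3)

theorem IsCutGroup.eq_of_prime_dvd_card_of_odd (hcut : IsCutGroup G) (hN' : N ≠ ⊤)
    (hc : ∀ n ∈ N, n ≠ 1 → ∀ g, g * n = n * g → g ∈ N) (hodd : Odd (Nat.card (G ⧸ N))) {q : ℕ}
    (hq : q.Prime) (hqN : q ∣ Nat.card N) : q = 2 ∨ q = 3 ∨ q = 7 := by
  have hN : N ≠ ⊥ := by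
    rintro rfl
    rw [Subgroup.card_bot, Nat.dvd_one] at hqN
    exact hq.one_lt.ne' hqN
  obtain ⟨V, hV, φ, -, -, ⟨v, hv⟩, -, hord⟩ := hcut.exists_mulAut N ⊤ le_top
    (fun h => hN' (top_le_iff.1 h)) (fun n hn hn1 g _ => hc n hn hn1 g) hq hqN
  obtain ⟨h, σ, -, hn⟩ := hord v hv
  have h3 := orderOf_dvd_three_of_odd_card (hcut.orderOf_quotient_dvd_twelve hN hN' hc) hodd h
  have h6 := (hn 3 (by rw [orderOf_dvd_iff_pow_eq_one.1 h3, map_one, MulAut.one_apply])).1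
  have hle := Nat.le_of_dvd (by norm_num) h6
  have hq8 : q ≤ 7 := by omega
  interval_cases q <;> revert hq h6 <;> norm_num

theorem exists_conj_eq_inv (hc : ∀ n ∈ N, n ≠ 1 → ∀ g, g * n = n * g → g ∈ N)
    (heven : 2 ∣ Nat.card (G ⧸ N)) :
    ∃ t, t ∉ N ∧ t ^ 2 = 1 ∧ ∀ n ∈ N, t * n * t⁻¹ = n⁻¹ := by
  obtain ⟨y, hy⟩ := exists_prime_orderOf_dvd_card' 2 heven
  obtain ⟨t, rfl⟩ := QuotientGroup.mk'_surjective N y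
  have htN : t ∉ N := fun h => by
    have h1 : QuotientGroup.mk' N t = 1 := (QuotientGroup.eq_one_iff t).2 h
    rw [h1, orderOf_one] at hy
    norm_num at hy
  have ht2N : t ^ 2 ∈ N := by
    refine (QuotientGroup.eq_one_iff (t ^ 2)).1 ?_
    have := pow_orderOf_eq_one (QuotientGroup.mk' N t)
    rwa [hy, ← map_pow] at this
  have ht2 : t ^ 2 = 1 := by
    by_contra h
    exact htN (hc _ ht2N h t ((Commute.refl t).pow_right 2))
  refine ⟨t, htN, ht2, fun m hm => ?_⟩
  let f : N → N := fun n => ⟨n * (t * (n : G)⁻¹ * t⁻¹),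
    N.mul_mem n.2 (Subgroup.Normal.conj_mem inferInstance _ (N.inv_mem n.2) _)⟩
  have hf : Function.Injective f := by
    intro a b hab
    have h1 : (a : G) * (t * (a : G)⁻¹ * t⁻¹) = b * (t * (b : G)⁻¹ * t⁻¹) :=
      congrArg Subtype.val hab
    have h3 : (a : G) * t * (a : G)⁻¹ = b * t * (b : G)⁻¹ := by
      simpa [← mul_assoc] using h1
    by_contra hne
    refine htN (hc ((b : G)⁻¹ * a) (N.mul_mem (N.inv_mem b.2) a.2)
      (fun h => hne (Subtype.ext (inv_mul_eq_one.1 h).symm)) t ?_)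
    symm
    calc (b : G)⁻¹ * a * t = (b : G)⁻¹ * ((a : G) * t * (a : G)⁻¹) * a := by group
      _ = _ := by rw [h3]; group
  obtain ⟨n, hn⟩ := (Finite.injective_iff_surjective.1 hf) ⟨m, hm⟩
  have hn' : (n : G) * (t * (n : G)⁻¹ * t⁻¹) = m := congrArg Subtype.val hn
  have htt : t⁻¹ = t := by rw [inv_eq_iff_mul_eq_one, ← pow_two, ht2]
  rw [← hn', htt]
  simp only [mul_inv_rev, inv_inv, htt, mul_assoc]
  rw [← pow_two, ht2, mul_one]

theorem mul_comm_of_conj_eq_inv {G : Type*} [Group G] {N : Subgroup G} {t : G}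
    (ht : ∀ n ∈ N, t * n * t⁻¹ = n⁻¹) {a b : G} (ha : a ∈ N) (hb : b ∈ N) : a * b = b * a := by
  have h1 := ht _ (N.mul_mem ha hb)
  rw [← conj_mul, ht a ha, ht b hb, ← mul_inv_rev, inv_inj] at h1
  exact h1.symm

theorem IsCutGroup.prime_eq_of_even (hcut : IsCutGroup G)
    (hc : ∀ n ∈ N, n ≠ 1 → ∀ g, g * n = n * g → g ∈ N) (heven : 2 ∣ Nat.card (G ⧸ N)) {q r : ℕ}
    (hq : q.Prime) (hqN : q ∣ Nat.card N) (hr : r.Prime) (hrN : r ∣ Nat.card N) : q = r := by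
  by_contra hqr
  have := Fact.mk hq
  have := Fact.mk hr
  obtain ⟨t, -, -, ht⟩ := exists_conj_eq_inv hc heven
  have hne2 : ∀ p, p.Prime → p ∣ Nat.card N → p ≠ 2 := by
    rintro _ hp hpN rfl
    exact not_dvd_card_quotient hc hp hpN heven
  obtain ⟨v, hv⟩ := exists_prime_orderOf_dvd_card' q hqN
  obtain ⟨w, hw⟩ := exists_prime_orderOf_dvd_card' r hrN
  have hcop : Nat.Coprime q r := (Nat.coprime_primes hq hr).2 hqr
  have hvw : Commute v w := Subtype.ext (mul_comm_of_conj_eq_inv ht v.2 w.2)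
  have hx : orderOf (v * w) = q * r := by
    rw [hvw.orderOf_mul_eq_mul_orderOf_of_coprime (by rw [hv, hw]; exact hcop), hv, hw]
  rw [← Subgroup.orderOf_coe] at hx
  set x : G := ((v * w : N) : G) with hxdef
  have hxN : x ∈ N := (v * w).2
  have hxz : ∀ a b : ℤ, x ^ a = x ^ b ↔ ((q * r : ℕ) : ℤ) ∣ a - b := by
    intro a b
    rw [zpow_eq_zpow_iff_modEq, hx, Int.modEq_comm, Int.modEq_iff_dvd]
  have key : ∀ a b : ℕ, a.Prime → a ∣ Nat.card N → b.Prime → a * b = q * r → ∀ (d : G) (k : ℤ),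
      (b : ℤ) ∣ k - 1 → (a : ℤ) ∣ k + 1 → d * x * d⁻¹ ≠ x ^ k := by
    intro a b hap haN hbp hab d k h1 h2 hd
    have hxb : orderOf (x ^ b) = a := by
      rw [orderOf_pow_of_dvd hbp.ne_zero (by rw [hx, ← hab]; exact dvd_mul_left _ _), hx, ← hab,
        Nat.mul_div_cancel _ hbp.pos]
    have hxa : orderOf (x ^ a) = b := by
      rw [orderOf_pow_of_dvd hap.ne_zero (by rw [hx, ← hab]; exact dvd_mul_right _ _), hx, ← hab,
        Nat.mul_div_cancel_left _ hap.pos]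
    have hdj := fun j : ℕ => conj_zpow_of_conj_eq hd j
    have hda : x ^ (k * a) = x ^ (a : ℤ) := by
      rw [hxz, ← hab]
      obtain ⟨c, hc⟩ := h1
      exact ⟨c, by push_cast; linear_combination a * hc⟩
    have hdN : d ∈ N := by
      refine hc (x ^ a) (N.pow_mem hxN a) (fun h => ?_) d ?_
      · rw [h, orderOf_one] at hxa
        exact hbp.one_lt.ne hxa
      · have := hdj a
        rw [hda] at this
        exact_mod_cast this
    have hcomm := mul_comm_of_conj_eq_inv ht hdN hxN
    rw [hcomm, mul_inv_cancel_right] at hd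
    have h3 : ((a : ℕ) : ℤ) ∣ k - 1 := by
      have h4 := (hxz k 1).1 (by rw [zpow_one]; exact hd.symm)
      rw [← hab] at h4
      push_cast at h4
      exact (dvd_mul_right _ _).trans h4
    have h5 : (a : ℤ) ∣ 2 := by
      have := dvd_sub h2 h3
      ring_nf at this
      exact this
    have h6 : a ∣ 2 := by exact_mod_cast h5
    exact hne2 a hap haN ((Nat.prime_dvd_prime_iff_eq hap Nat.prime_two).1 h6)
  obtain ⟨k, hk1, hk2⟩ : ∃ k : ℤ, (q : ℤ) ∣ k - 1 ∧ (r : ℤ) ∣ k + 1 := by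
    obtain ⟨a, b, hab⟩ := Nat.isCoprime_iff_coprime.2 hcop
    refine ⟨b * r - a * q, ⟨-2 * a, ?_⟩, ⟨2 * b, ?_⟩⟩
    · linear_combination hab
    · linear_combination -hab
  have hk : Int.gcd k (orderOf x) = 1 := by
    rw [hx, ← Int.isCoprime_iff_gcd_eq_one]
    push_cast
    obtain ⟨a, ha⟩ := hk1
    obtain ⟨b, hb⟩ := hk2
    exact IsCoprime.mul_right ⟨1, -a, by linear_combination ha⟩ ⟨-1, b, by linear_combination -hb⟩
  obtain ⟨d, hd⟩ := hcut.exists_conj_eq_zpow x k hk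
  rcases hd with hd | hd
  · exact key r q hr hrN hq (mul_comm _ _) d k hk1 hk2 hd
  · refine key q r hq hqN hr rfl d (-k) ?_ ?_ hd
    · obtain ⟨c, hc⟩ := hk2
      exact ⟨-c, by linear_combination -hc⟩
    · obtain ⟨c, hc⟩ := hk1
      exact ⟨-c, by linear_combination -hc⟩

theorem IsCutGroup.card_primeFactors_le_three (hcut : IsCutGroup G) (hN : N ≠ ⊥) (hN' : N ≠ ⊤)
    (hc : ∀ n ∈ N, n ≠ 1 → ∀ g, g * n = n * g → g ∈ N) :
    (Nat.card G).primeFactors.card ≤ 3 := by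
  have h12 := hcut.orderOf_quotient_dvd_twelve hN hN' hc
  obtain ⟨r, hr⟩ : ∃ r, ∀ p, p.Prime → p ∣ Nat.card N → p = 2 ∨ p = 3 ∨ p = r := by
    by_cases heven : 2 ∣ Nat.card (G ⧸ N)
    · obtain ⟨q, hq, hqN⟩ := Nat.exists_prime_and_dvd
        (fun h => hN (Subgroup.card_eq_one.1 h) : Nat.card N ≠ 1)
      exact ⟨q, fun p hp hpN => Or.inr (Or.inr (hcut.prime_eq_of_even hc heven hp hpN hq hqN))⟩
    · exact ⟨7, fun p hp hpN => hcut.eq_of_prime_dvd_card_of_odd hN' hc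
        (Nat.not_even_iff_odd.1 fun h => heven h.two_dvd) hp hpN⟩
  refine Nat.card_primeFactors_le_three_of_forall (r := r) fun p hp hpG => ?_
  rw [Subgroup.card_eq_card_quotient_mul_card_subgroup N] at hpG
  rcases (hp.dvd_mul).1 hpG with h | h
  · exact (eq_two_or_three_of_dvd_card_of_orderOf_dvd h12 hp h).imp_right Or.inl
  · exact hr p hp h
end

section
variable {Y : Type u} [Group Y] {B : Subgroup Y} [B.Normal]

theorem pow_mem_of_orderOf_quotient_dvd {y : Y} {n : ℕ}
    (h : orderOf (QuotientGroup.mk' B y) ∣ n) : y ^ n ∈ B :=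
  (QuotientGroup.eq_one_iff (y ^ n)).1 (orderOf_dvd_iff_pow_eq_one.1 h)

omit [B.Normal] in
theorem pow_eq_one_of_notMem (hc : ∀ b ∈ B, b ≠ 1 → ∀ y, y * b = b * y → y ∈ B) {y : Y} {n : ℕ}
    (hy : y ∉ B) (hn : y ^ n ∈ B) : y ^ n = 1 := by
  by_contra h
  exact hy (hc _ hn h y ((Commute.refl y).pow_right n))

variable [Finite Y]

theorem odd_card_of_actsFreely {E : Type*} [Ring E] [Nontrivial E] {ρ : B →* E}
    (hρ : ρ.ActsFreely) (hB : B ≠ ⊤) (hc : ∀ b ∈ B, b ≠ 1 → ∀ y, y * b = b * y → y ∈ B) :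
    Odd (Nat.card B) := by
  rw [← Nat.not_even_iff_odd]
  intro heven
  obtain ⟨s, hs⟩ := exists_prime_orderOf_dvd_card' 2 heven.two_dvd
  have hs1 : s ≠ 1 := by rintro rfl; rw [orderOf_one] at hs; norm_num at hs
  have hs2 : s ^ 2 = 1 := hs ▸ pow_orderOf_eq_one s
  refine hB (eq_top_iff.2 fun y _ => hc s s.2 (fun h => hs1 (Subtype.ext h)) y ?_)
  have h1 := hρ.eq_of_sq_eq_one (s := ⟨y * s * y⁻¹, Subgroup.Normal.conj_mem inferInstance _ s.2 y⟩)
    (fun h => hs1 (Subtype.ext (by simpa using h))) (Subtype.ext (by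
      have : (s : Y) ^ 2 = 1 := congrArg Subtype.val hs2
      simp [conj_pow, this])) hs1 hs2
  exact mul_inv_eq_iff_eq_mul.1 (congrArg Subtype.val h1)

theorem IsCutGroup.eq_seven_of_prime_dvd_card (hcut : IsCutGroup Y) (hB : B ≠ ⊥) (hB' : B ≠ ⊤)
    (hc : ∀ b ∈ B, b ≠ 1 → ∀ y, y * b = b * y → y ∈ B) (hBodd : Odd (Nat.card B))
    (hodd : Odd (Nat.card (Y ⧸ B))) {p : ℕ} (hp : p.Prime) (hpB : p ∣ Nat.card B) : p = 7 := by
  rcases hcut.eq_of_prime_dvd_card_of_odd hB' hc hodd hp hpB with rfl | rfl | rfl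
  · exact absurd hBodd (Nat.not_odd_iff_even.2 (even_iff_two_dvd.2 hpB))
  · have h3 := orderOf_dvd_three_of_odd_card (hcut.orderOf_quotient_dvd_twelve hB hB' hc) hodd
    obtain ⟨y, hy⟩ := SetLike.exists_not_mem_of_ne_top B hB'
    rcases (Nat.dvd_prime Nat.prime_three).1 (h3 (QuotientGroup.mk' B y)) with h | h
    · exact absurd ((QuotientGroup.eq_one_iff y).1 (orderOf_eq_one_iff.1 h)) hy
    · exact absurd (h ▸ orderOf_dvd_natCard (QuotientGroup.mk' B y)) (not_dvd_card_quotient hc hp hpB)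
  · rfl

theorem IsCutGroup.pow_three_eq_one_or (hcut : IsCutGroup Y) (hB : B ≠ ⊥) (hB' : B ≠ ⊤)
    (hc : ∀ b ∈ B, b ≠ 1 → ∀ y, y * b = b * y → y ∈ B) (hBodd : Odd (Nat.card B))
    (hodd : Odd (Nat.card (Y ⧸ B))) (y : Y) : y ^ 3 = 1 ∨ ∃ j, y ^ 7 ^ j = 1 := by
  by_cases hy : y ∈ B
  · right
    refine ⟨_, orderOf_dvd_iff_pow_eq_one.1 (dvd_of_eq (Nat.eq_prime_pow_of_unique_prime_dvd
      (orderOf_pos y).ne' fun {p} hp hpy => ?_))⟩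
    refine hcut.eq_seven_of_prime_dvd_card hB hB' hc hBodd hodd hp (hpy.trans ?_)
    rw [← Subgroup.orderOf_mk y hy]
    exact orderOf_dvd_natCard _
  · exact Or.inl (pow_eq_one_of_notMem hc hy (pow_mem_of_orderOf_quotient_dvd
      (orderOf_dvd_three_of_odd_card (hcut.orderOf_quotient_dvd_twelve hB hB' hc) hodd _)))

theorem eq_two_or_three_of_dvd_seven_pow {q j : ℕ} (hq : q.Prime) (h : q - 1 ∣ 2 * 7 ^ j) :
    q = 2 ∨ q = 3 := by
  rcases hq.eq_two_or_odd' with rfl | ⟨m, hm⟩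
  · exact Or.inl rfl
  right
  have h1 : m ∣ 7 ^ j := Nat.dvd_of_mul_dvd_mul_left (by norm_num : 0 < 2)
    (by rwa [show 2 * m = q - 1 by omega])
  obtain ⟨i, -, rfl⟩ := (Nat.dvd_prime_pow (by norm_num)).1 h1
  have h2 : 7 ^ i % 3 = 1 := by simp [Nat.pow_mod]
  exact ((Nat.prime_dvd_prime_iff_eq Nat.prime_three hq).1 (by omega)).symm

omit [Finite Y] in
theorem exists_conj_eq_zpow_of_actsFreely {E : Type*} [Ring E] [Nontrivial E] {ρ : B →* E}
    (hρ : ρ.ActsFreely) (hρc : ∀ e : E, (Nat.card B : E) * e = 0 → e = 0)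
    (hBcomm : ∀ a ∈ B, ∀ b ∈ B, a * b = b * a) {p : ℕ} (hp : p.Prime) {b : Y} (hb : b ∈ B)
    (hbp : orderOf b = p) (y : Y) : ∃ σ : ℤ, y * b * y⁻¹ = b ^ σ := by
  have hyB : y * b * y⁻¹ ∈ B := Subgroup.Normal.conj_mem inferInstance b hb y
  obtain ⟨σ, hσ⟩ := hρ.mem_zpowers_of_commute hρc hp (a := ⟨b, hb⟩) (b := ⟨y * b * y⁻¹, hyB⟩)
    (by rw [Subgroup.orderOf_mk, hbp])
    (Subtype.ext (by simp [conj_pow, hbp ▸ pow_orderOf_eq_one b]))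
    (Subtype.ext (hBcomm _ hb _ hyB))
  exact ⟨σ, (congrArg Subtype.val hσ).symm⟩

omit [B.Normal] [Finite Y] in
theorem pow_pred_mem_of_conj_eq_zpow (hc : ∀ b ∈ B, b ≠ 1 → ∀ y, y * b = b * y → y ∈ B) {p : ℕ}
    (hp : p.Prime) {b : Y} (hb : b ∈ B) (hbp : orderOf b = p) {y : Y} {σ : ℤ}
    (hσ : y * b * y⁻¹ = b ^ σ) : y ^ (p - 1) ∈ B := by
  have hb1 : b ≠ 1 := fun h => by rw [h, orderOf_one] at hbp; exact hp.one_lt.ne hbp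
  refine hc b hb hb1 _ ?_
  have h1 := conj_pow_of_conj_eq hσ (p - 1)
  have hcop : IsCoprime σ p := by
    rw [Int.isCoprime_iff_gcd_eq_one, Int.gcd_comm]
    refine (hp.coprime_iff_not_dvd).2 fun hd => hb1 ?_
    have h2 : b ^ σ = 1 := orderOf_dvd_iff_zpow_eq_one.1 (by rw [hbp]; exact Int.natCast_dvd.2 hd)
    rw [h2] at hσ
    simpa using hσ
  have h2 : b ^ σ ^ (p - 1) = b ^ (1 : ℤ) := by
    rw [zpow_eq_zpow_iff_modEq, hbp]
    exact Int.ModEq.pow_card_sub_one_eq_one hp hcop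
  rw [h2, zpow_one] at h1
  exact mul_inv_eq_iff_eq_mul.1 h1

omit [Finite Y] in
theorem quotient_mul_comm_of_conj_eq_zpow
    (hc : ∀ b ∈ B, b ≠ 1 → ∀ y, y * b = b * y → y ∈ B) {b : Y} (hb : b ∈ B) (hb1 : b ≠ 1)
    (hσ : ∀ y : Y, ∃ σ : ℤ, y * b * y⁻¹ = b ^ σ) (c d : Y ⧸ B) : c * d = d * c := by
  obtain ⟨x, rfl⟩ := QuotientGroup.mk'_surjective B c
  obtain ⟨y, rfl⟩ := QuotientGroup.mk'_surjective B d
  obtain ⟨σ, hx⟩ := hσ x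
  obtain ⟨τ, hy⟩ := hσ y
  rw [← map_mul, ← map_mul]
  refine QuotientGroup.eq.2 (hc b hb hb1 _ ?_)
  have h1 : x * y * b = b ^ (σ * τ) * (x * y) := by
    rw [mul_assoc, mul_inv_eq_iff_eq_mul.1 hy, ← mul_assoc, conj_zpow_of_conj_eq hx, mul_assoc]
  have h2 : y * x * b = b ^ (σ * τ) * (y * x) := by
    rw [mul_assoc, mul_inv_eq_iff_eq_mul.1 hx, ← mul_assoc, conj_zpow_of_conj_eq hy, mul_assoc,
      mul_comm]
  rw [mul_assoc, h2, ← mul_assoc, inv_mul_eq_iff_eq_mul.2, mul_assoc]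
  rw [← mul_assoc, h1]
  simp [mul_assoc]

/-- In a cut group with an abelian Frobenius kernel `B`, in which every element normalizes a
subgroup of order `p` of `B`, the prime `p` is small. -/
theorem IsCutGroup.eq_of_conj_eq_zpow (hcut : IsCutGroup Y) (hB : B ≠ ⊥) (hB' : B ≠ ⊤)
    (hc : ∀ b ∈ B, b ≠ 1 → ∀ y, y * b = b * y → y ∈ B)
    (hBcomm : ∀ a ∈ B, ∀ b ∈ B, a * b = b * a) {p : ℕ} (hp : p.Prime) (hp2 : p ≠ 2) {b : Y}
    (hb : b ∈ B) (hbp : orderOf b = p) (hσ : ∀ y : Y, ∃ σ : ℤ, y * b * y⁻¹ = b ^ σ) :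
    p = 3 ∨ p = 5 ∨ p = 7 := by
  have hb1 : b ≠ 1 := fun h => by rw [h, orderOf_one] at hbp; exact hp.one_lt.ne hbp
  obtain ⟨d, -, -, hn⟩ := exists_apply_eq_zpow_of_cut MulAut.conj hp hbp fun k hk =>
    hcut.exists_conj_eq_zpow b k (by rw [hbp]; exact hk)
  have h12 := hcut.orderOf_quotient_dvd_twelve hB hB' hc (QuotientGroup.mk' B d)
  obtain ⟨h1, h2⟩ := hn (orderOf (QuotientGroup.mk' B d)) (mul_inv_eq_iff_eq_mul.2
    (hBcomm _ (pow_mem_of_orderOf_quotient_dvd dvd_rfl) _ hb))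
  have h24 : p - 1 ∣ 24 := h1.trans (mul_dvd_mul_left 2 h12)
  have h4 : 4 ∣ p - 1 → p - 1 ∣ 12 := fun h => (h2 h).trans h12
  have hle := Nat.le_of_dvd (by norm_num) h24
  have hp25 : p ≤ 25 := by omega
  have h13 : p ≠ 13 := by
    rintro rfl
    have ho : orderOf (QuotientGroup.mk' B d) = 12 := Nat.dvd_antisymm h12 (h2 (by norm_num))
    obtain ⟨z, hz⟩ := (hcut.of_surjective _ (QuotientGroup.mk'_surjective B)).exists_conj_eq_zpow
      (QuotientGroup.mk' B d) 5 (by rw [ho]; rfl)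
    rw [quotient_mul_comm_of_conj_eq_zpow hc hb hb1 hσ z, mul_inv_cancel_right] at hz
    have hz' : QuotientGroup.mk' B d ^ (1 : ℤ) = QuotientGroup.mk' B d ^ (5 : ℤ) ∨
        QuotientGroup.mk' B d ^ (1 : ℤ) = QuotientGroup.mk' B d ^ (-5 : ℤ) := by rwa [zpow_one]
    simp only [zpow_eq_zpow_iff_modEq, ho] at hz'
    revert hz'
    decide
  interval_cases p <;> revert hp h24 h4 hp2 h13 <;> norm_num

omit [B.Normal] [Finite Y] in
theorem pow_eq_one_of_apply_eq_zpow {V : Type*} [CommGroup V] (φ : Y →* MulAut V)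
    (hφ : ∀ b ∈ B, b ≠ 1 → ∀ v, φ b v = v → v = 1) (hBodd : Odd (Nat.card B)) {t : Y}
    (ht : ∀ b ∈ B, t * b * t⁻¹ = b⁻¹) {v : V} (hv : v ≠ 1) {τ σ : ℤ} (hτ : φ t v = v ^ τ) {y : Y}
    (hσ : φ y v = v ^ σ) {n : ℕ} (hn : y ^ n ∈ B) : y ^ n = 1 := by
  have h1 := MulAut.pow_apply_eq_zpow φ hσ n
  set b := y ^ n
  have h2 : φ (b⁻¹ * t) v = φ (b * t) v := by
    rw [← mul_inv_eq_iff_eq_mul.1 (ht b hn)]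
    rw [map_mul, map_mul, MulAut.mul_apply, MulAut.mul_apply, h1, hτ, map_zpow, map_zpow, h1, hτ,
      ← zpow_mul, ← zpow_mul, mul_comm]
  have h3 : φ (b ^ 2) (φ t v) = φ t v := by
    have h4 := congrArg (φ b) h2
    rw [← MulAut.mul_apply, ← MulAut.mul_apply, ← map_mul, ← map_mul, mul_inv_cancel_left,
      ← mul_assoc, ← pow_two, map_mul, MulAut.mul_apply] at h4
    exact h4.symm
  have h5 : b ^ 2 = 1 := by
    by_contra h
    exact hv ((map_eq_one_iff _ (φ t).injective).1 (hφ _ (B.pow_mem hn 2) h _ h3))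
  have h6 : orderOf b ∣ Nat.card B := by
    rw [← Subgroup.orderOf_mk b hn]
    exact orderOf_dvd_natCard _
  have h7 := (Nat.coprime_two_left.2 hBodd).gcd_eq_one
  have h8 := Nat.dvd_gcd (orderOf_dvd_of_pow_eq_one h5) h6
  rwa [h7, Nat.dvd_one, orderOf_eq_one_iff] at h8

omit [Finite Y] in
theorem exists_apply_eq_zpow_of_sq_eq_one {V : Type*} [CommGroup V] (φ : Y →* MulAut V) {t : Y}
    (ht : t ^ 2 = 1) {q : ℕ} (hq : q.Prime) {v : V} (hv : orderOf v = q) :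
    ∃ w : V, orderOf w = q ∧ ∃ τ : ℤ, φ t w = w ^ τ := by
  by_cases h : v * φ t v = 1
  · exact ⟨v, hv, -1, by rw [zpow_neg_one, eq_inv_of_mul_eq_one_right h]⟩
  · have := Fact.mk hq
    have hvq : v ^ q = 1 := hv ▸ pow_orderOf_eq_one v
    refine ⟨_, orderOf_eq_prime (by rw [mul_pow, ← map_pow, hvq, map_one, mul_one]) h, 1, ?_⟩
    rw [zpow_one, map_mul, ← MulAut.mul_apply, ← map_mul, ← pow_two, ht, map_one, MulAut.one_apply,
      mul_comm]
end

theorem IsCutGroup.card_primeFactors_le_three_of_two_step {G : Type u} [Group G] [Finite G]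
    (hcut : IsCutGroup G) (N K : Subgroup G) [N.Normal] [K.Normal] (hN : N ≠ ⊥) (hNK : N ≤ K)
    (hKN : ¬ K ≤ N) (hc : ∀ n ∈ N, n ≠ 1 → ∀ g ∈ K, g * n = n * g → g ∈ N)
    (hB' : K.map (QuotientGroup.mk' N) ≠ ⊤)
    (hBc : ∀ b ∈ K.map (QuotientGroup.mk' N), b ≠ 1 → ∀ y, y * b = b * y →
      y ∈ K.map (QuotientGroup.mk' N)) :
    (Nat.card G).primeFactors.card ≤ 3 := by
  have hBn : (K.map (QuotientGroup.mk' N)).Normal :=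
    Subgroup.Normal.map inferInstance _ (QuotientGroup.mk'_surjective N)
  have hB : K.map (QuotientGroup.mk' N) ≠ ⊥ := by
    rw [Ne, Subgroup.map_eq_bot_iff, QuotientGroup.ker_mk']
    exact hKN
  have hYcut : IsCutGroup (G ⧸ N) := hcut.of_surjective _ (QuotientGroup.mk'_surjective N)
  obtain ⟨E, hE, hE', ρ, hρ, hρc⟩ := exists_actsFreely_of_centralizer_le N K hN hNK hKN hc
  have hV := fun q => hcut.exists_mulAut (q := q) N K hNK hKN hc
  have hcard := Subgroup.card_eq_card_quotient_mul_card_subgroup N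
  generalize K.map (QuotientGroup.mk' N) = B at *
  have hBodd := odd_card_of_actsFreely hρ hB' hBc
  have h12 := hYcut.orderOf_quotient_dvd_twelve hB hB' hBc
  suffices h : ∃ r, (∀ p, p.Prime → p ∣ Nat.card B → p = 2 ∨ p = 3 ∨ p = r) ∧
      ∀ q, q.Prime → q ∣ Nat.card N → q = 2 ∨ q = 3 ∨ q = r by
    obtain ⟨r, hrB, hrN⟩ := h
    refine Nat.card_primeFactors_le_three_of_forall (r := r) fun p hp hpG => ?_
    rw [hcard, Subgroup.card_eq_card_quotient_mul_card_subgroup B] at hpG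
    rcases (hp.dvd_mul).1 hpG with h | h
    · rcases (hp.dvd_mul).1 h with h | h
      · exact (eq_two_or_three_of_dvd_card_of_orderOf_dvd h12 hp h).imp_right Or.inl
      · exact hrB p hp h
    · exact hrN p hp h
  by_cases heven : 2 ∣ Nat.card ((G ⧸ N) ⧸ B)
  · obtain ⟨t, -, ht2, ht⟩ := exists_conj_eq_inv hBc heven
    have hBcomm : ∀ a ∈ B, ∀ b ∈ B, a * b = b * a := fun a ha b hb =>
      mul_comm_of_conj_eq_inv ht ha hb
    obtain ⟨p, hp, hpB⟩ := Nat.exists_prime_and_dvd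
      (fun h => hB (Subgroup.card_eq_one.1 h) : Nat.card B ≠ 1)
    have := Fact.mk hp
    obtain ⟨⟨b, hb⟩, hbp⟩ := exists_prime_orderOf_dvd_card' p hpB
    rw [Subgroup.orderOf_mk] at hbp
    have hp2 : p ≠ 2 := by
      rintro rfl
      exact (Nat.not_even_iff_odd.2 hBodd) (even_iff_two_dvd.2 hpB)
    have hσ := exists_conj_eq_zpow_of_actsFreely hρ hρc hBcomm hp hb hbp
    refine ⟨p, fun r hr hrB => Or.inr (Or.inr (hYcut.prime_eq_of_even hBc heven hr hrB hp hpB)),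
      fun q hq hqN => ?_⟩
    obtain ⟨V, hV, φ, -, -, ⟨v, hv⟩, hfree, hord⟩ := hV q hq hqN
    obtain ⟨w, hw, τ, hτ⟩ := exists_apply_eq_zpow_of_sq_eq_one φ ht2 hq hv
    obtain ⟨y, σ, hyσ, hn⟩ := hord w hw
    obtain ⟨υ, hυ⟩ := hσ y
    have hy := pow_eq_one_of_apply_eq_zpow φ hfree hBodd ht
      (fun h => by rw [h, orderOf_one] at hw; exact hq.one_lt.ne hw) hτ hyσ
      (pow_pred_mem_of_conj_eq_zpow hBc hp hb hbp hυ)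
    obtain ⟨h1, h2⟩ := hn (p - 1) (by rw [hy, map_one, MulAut.one_apply])
    have hp357 := hYcut.eq_of_conj_eq_zpow hB hB' hBc hBcomm hp hp2 hb hbp hσ
    have hle := Nat.le_of_dvd (by have := hp.two_le; omega) h1
    have hq13 : q ≤ 13 := by omega
    clear hn hord
    rcases hp357 with rfl | rfl | rfl <;> interval_cases q <;> revert hq h1 h2 <;> norm_num
  · have hodd : Odd (Nat.card ((G ⧸ N) ⧸ B)) :=
      Nat.not_even_iff_odd.1 fun h => heven h.two_dvd
    refine ⟨7, fun p hp hpB => Or.inr (Or.inr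
      (hYcut.eq_seven_of_prime_dvd_card hB hB' hBc hBodd hodd hp hpB)), fun q hq hqN => ?_⟩
    obtain ⟨V, hV, φ, -, -, ⟨v, hv⟩, -, hord⟩ := hV q hq hqN
    obtain ⟨y, -, -, hn⟩ := hord v hv
    rcases hYcut.pow_three_eq_one_or hB hB' hBc hBodd hodd y with hy | ⟨j, hy⟩
    · have h6 := (hn 3 (by rw [hy, map_one, MulAut.one_apply])).1
      have hle := Nat.le_of_dvd (by norm_num) h6
      have hq7 : q ≤ 7 := by omega
      clear hn hord
      interval_cases q <;> revert hq h6 <;> norm_num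
    · have h7 := (hn (7 ^ j) (by rw [hy, map_one, MulAut.one_apply])).1
      exact (eq_two_or_three_of_dvd_seven_pow hq h7).imp_right Or.inl

theorem stmt_12 (G : Type*) [Group G] [Finite G] (hcut : IsCutGroup G)
    (h : IsFrobeniusGroup G ∨ Is2FrobeniusGroup G) :
    (Nat.card G).primeFactors.card ≤ 3 := by
  rcases h with h | ⟨N, K, hN, hK, hNK, ⟨h1, h2, -, -, -, -, h3⟩, h4, h5, -, -, -, -, h6⟩
  · obtain ⟨N, hN, hbot, htop, hc⟩ := IsFrobeniusGroup.exists_kernel h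
    exact hcut.card_primeFactors_le_three hbot htop hc
  · refine hcut.card_primeFactors_le_three_of_two_step N K ?_ hNK ?_ ?_ h5 ?_
    · rintro rfl
      exact h1 (by simp)
    · exact fun h => h2 (Subgroup.subgroupOf_eq_top.2 h)
    · intro n hn hn1 g hg hgn
      refine Subgroup.mem_subgroupOf.1 (h3 ⟨n, hNK hn⟩ (Subgroup.mem_subgroupOf.2 hn)
        (fun h => hn1 (congrArg Subtype.val h)) (x := ⟨g, hg⟩) ?_)
      rw [Subgroup.mem_centralizer_singleton_iff]
      exact Subtype.ext hgn
    · intro b hb hb1 y hy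
      refine h6 b hb hb1 ?_
      rw [Subgroup.mem_centralizer_singleton_iff]
      exact hy
end

section
/- Let G be a finite rational group which possesses a nilpotent normal subgroup N such that the quotient G/N is abelian. Then every prime dividing the order of G belongs to {2,3}. -/
open scoped commutatorElement in
/-- A nontrivial normal subgroup of a nilpotent group meets the center nontrivially. -/
theorem Subgroup.Normal.exists_ne_one_mem_center {H : Type*} [Group H] [Group.IsNilpotent H]
    {P : Subgroup H} (hP : P.Normal) (hne : P ≠ ⊥) :
    ∃ x ∈ P, x ≠ 1 ∧ x ∈ Subgroup.center H := by
  classical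
  have hex : ∃ n, ∃ x ∈ P, x ≠ 1 ∧ x ∈ Subgroup.upperCentralSeries H n := by
    obtain ⟨n, hn⟩ := Group.IsNilpotent.nilpotent H
    obtain ⟨x, hxP, hx⟩ := (P.bot_or_exists_ne_one).resolve_left hne
    exact ⟨n, x, hxP, hx, hn ▸ Subgroup.mem_top x⟩
  obtain ⟨x, hxP, hx, hxn⟩ := Nat.find_spec hex
  refine ⟨x, hxP, hx, Subgroup.mem_center_iff.2 fun y => ?_⟩
  rcases hfind : Nat.find hex with _ | m
  · rw [hfind] at hxn
    exact absurd (by simpa using hxn) hx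
  · rw [hfind] at hxn
    by_contra hy
    refine Nat.find_min hex (m := m) (by lia) ⟨⁅x, y⁆, ?_, ?_, hxn y⟩
    · rw [commutatorElement_def, mul_assoc, mul_assoc]
      exact P.mul_mem hxP (by simpa [mul_assoc] using hP.conj_mem _ (P.inv_mem hxP) y)
    · rw [Ne, commutatorElement_eq_one_iff_mul_comm]
      exact fun h => hy h.symm

/-- A prime dividing the order of a finite nilpotent group divides the order of a central
element. -/
theorem Group.IsNilpotent.exists_mem_center_orderOf_eq {H : Type*} [Group H] [Finite H]
    [Group.IsNilpotent H] {p : ℕ} [hp : Fact p.Prime] (hdvd : p ∣ Nat.card H) :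
    ∃ x ∈ Subgroup.center H, orderOf x = p := by
  obtain ⟨P⟩ : Nonempty (Sylow p H) := inferInstance
  have hnormal : (P : Subgroup H).Normal :=
    inferInstance
  obtain ⟨x, hxP, hx, hxc⟩ := hnormal.exists_ne_one_mem_center (P.ne_bot_of_dvd_card hdvd)
  obtain ⟨k, hk⟩ := (IsPGroup.iff_orderOf.1 P.2) ⟨x, hxP⟩
  rw [Subgroup.orderOf_mk] at hk
  have hpx : p ∣ orderOf x := by
    rcases k with _ | k
    · exact absurd (orderOf_eq_one_iff.1 (by simpa using hk)) hx
    · exact hk ▸ dvd_pow_self p k.succ_ne_zero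
  exact ⟨x ^ (orderOf x / p), Subgroup.pow_mem _ hxc _,
    orderOf_pow_orderOf_div (orderOf_pos x).ne' hpx⟩

/-- An abelian quotient of a rational group has exponent dividing two. -/
theorem IsRationalGroup.sq_mem {G : Type*} [Group G] (hrat : IsRationalGroup G)
    (N : Subgroup G) [N.Normal] (hab : ∀ a b : G ⧸ N, a * b = b * a) (g : G) : g ^ 2 ∈ N := by
  obtain ⟨c, hc⟩ := isConj_iff.1 (hrat g (-1) (by simp))
  have h := congrArg (QuotientGroup.mk (s := N)) hc
  rw [QuotientGroup.mk_mul, QuotientGroup.mk_mul, hab (c : G ⧸ N), mul_assoc,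
    ← QuotientGroup.mk_mul N c, mul_inv_cancel, QuotientGroup.mk_one, mul_one] at h
  rw [← QuotientGroup.eq_one_iff, pow_two, QuotientGroup.mk_mul]
  nth_rewrite 1 [← h]
  simp

theorem stmt_17 (G : Type*) [Group G] [Finite G] (hrat : IsRationalGroup G)
    (N : Subgroup G) [N.Normal] (hnil : Group.IsNilpotent ↥N)
    (hab : ∀ a b : G ⧸ N, a * b = b * a) :
    (Nat.card G).primeFactors ⊆ {2, 3} := by
  intro p hp
  have hpp := Nat.prime_of_mem_primeFactors hp
  have : Fact p.Prime := ⟨hpp⟩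
  by_cases hp2 : p = 2
  · simp [hp2]
  have hcop : Nat.Coprime 2 p := (Nat.coprime_primes Nat.prime_two hpp).2 (Ne.symm hp2)
  obtain ⟨y, hy⟩ := exists_prime_orderOf_dvd_card' p (Nat.dvd_of_mem_primeFactors hp)
  have hyN : y ^ 2 ∈ N := hrat.sq_mem N hab y
  have hdvd : p ∣ Nat.card N := by
    rw [← hy, ← Nat.Coprime.orderOf_pow (y := y) (m := 2) (by rwa [hy, Nat.coprime_comm])]
    exact N.orderOf_dvd_natCard hyN
  obtain ⟨⟨x, hxN⟩, hxc, hx⟩ := Group.IsNilpotent.exists_mem_center_orderOf_eq hdvd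
  rw [Subgroup.orderOf_mk] at hx
  obtain ⟨c, hc⟩ := isConj_iff.1 (hrat x 2 (by rw [hx]; exact_mod_cast hcop))
  have hcomm : c ^ 2 * x = x * c ^ 2 :=
    congrArg Subtype.val (Subgroup.mem_center_iff.1 hxc ⟨c ^ 2, hrat.sq_mem N hab c⟩)
  have hfour : x ^ 4 = x := by
    have hx2 : c * x ^ 2 * c⁻¹ = x := by exact_mod_cast hc
    calc x ^ 4 = c ^ 2 * x ^ 4 * (c ^ 2)⁻¹ := by
          rw [eq_mul_inv_iff_mul_eq]
          exact ((show Commute (c ^ 2) x from hcomm).pow_right 4).symm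
      _ = c * (c * x ^ 2 * c⁻¹) ^ 2 * c⁻¹ := by
          simp only [pow_succ, pow_zero, one_mul, mul_inv_rev, mul_assoc, inv_mul_cancel_left]
      _ = x := by rw [hx2, hx2]
  have hthree : x ^ 3 = 1 := by
    rwa [pow_succ x 3, mul_eq_right] at hfour
  have := (Nat.prime_dvd_prime_iff_eq hpp Nat.prime_three).1 (hx ▸ orderOf_dvd_of_pow_eq_one hthree)
  simp [this]
end
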